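/- arXiv:1111.7010 — 3 statements merged into one kernel-verified Lean document; each statement's English description precedes it below -/
import Mathlib

section
/- There exists a constant C > 0 depending only on f such that for all y ∈ (0,1] and all Y ≥ 1 one has | C_{f,1}(y,Y) − (1/(2√π)) c_f(4πyY²) | ≤ C · y^(1/2). -/
open MeasureTheory Real Filter Finset

/-- The Mellin-type kernel `W_k(x)`, written as the contour integral along `Re s = 5/4`. -/
noncomputable def Wk (k : ℕ) (x : ℝ) : ℂ :=
  (1 / (2 * Real.pi)) * ∫ t : ℝ,
    Complex.Gamma ((k : ℂ) + 1/4 + t * Complex.I) *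
      Complex.Gamma (3/4 + t * Complex.I) *
      (Complex.Gamma (3/4 - t * Complex.I))⁻¹ *
      (x : ℂ) ^ (-(5/4 + t * Complex.I))

/-- The transition function `c_f(α)`. -/
noncomputable def cf (k : ℕ) (lam : ℕ → ℝ) (α : ℝ) : ℂ :=
  ((Real.pi ^ ((3:ℝ)/2) / 2 * α : ℝ) : ℂ) *
    ∑' n : ℕ+, ((lam n)^2 : ℝ) * Wk k (Real.pi^2 * (n : ℕ) * α)

/-- The Dirichlet series `D(s) = ∑_{n≥1} λ(n)² n^(-s)`. -/
noncomputable def Dser (lam : ℕ → ℝ) (s : ℂ) : ℂ :=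
  ∑' n : ℕ+, (((lam n)^2 : ℝ) : ℂ) / ((n : ℕ) : ℂ) ^ s

/-- The confluent hypergeometric function `₁F₁(a,b,z) = ∑_{n≥0} (a)_n z^n / ((b)_n n!)`. -/
noncomputable def oneF1 (a b z : ℂ) : ℂ :=
  ∑' n : ℕ, ((ascPochhammer ℂ n).eval a * z ^ n) /
    ((ascPochhammer ℂ n).eval b * (n.factorial : ℂ))

/-- The function `C_{f,1}(y,Y)`, written as the contour integral along `Re s = 5/4`. -/
noncomputable def Cf1 (k : ℕ) (lam : ℕ → ℝ) (y Y : ℝ) : ℂ :=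
  ((Real.pi^2 * y * Y^2 : ℝ) : ℂ) * (1 / (2 * Real.pi)) * ∫ t : ℝ,
    Dser lam (5/4 + t * Complex.I) *
      Complex.Gamma ((k : ℂ) + 1/4 + t * Complex.I) *
      Complex.Gamma (3/4 + t * Complex.I) *
      (Complex.Gamma (3/4 - t * Complex.I))⁻¹ *
      oneF1 (-(1/4) - t * Complex.I) (1/2 - 2 * t * Complex.I)
        ((-(4 * Real.pi * y * Y) : ℝ) : ℂ) *
      ((4 * Real.pi^3 * y * Y^2 : ℝ) : ℂ) ^ (-(5/4 + t * Complex.I))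

open Topology

/-- Submultiplicativity of the divisor function, summed over the factorizations of `n`. -/
lemma sq_card_divisors_le (n : ℕ) :
    n.divisors.card ^ 2 ≤
      ∑ x ∈ n.divisorsAntidiagonal, x.1.divisors.card * x.2.divisors.card := by
  calc n.divisors.card ^ 2 = ∑ _x ∈ n.divisorsAntidiagonal, n.divisors.card := by
        rw [Finset.sum_const, smul_eq_mul, sq, ← Nat.map_div_right_divisors, Finset.card_map]
    _ ≤ _ := Finset.sum_le_sum fun x hx ↦ by
        rw [← (Nat.mem_divisorsAntidiagonal.1 hx).1, Nat.divisors_mul]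
        exact Finset.card_mul_le

open ArithmeticFunction ArithmeticFunction.zeta in
lemma summable_sq_card_divisors {c : ℝ} (hc : 1 < c) :
    Summable fun n : ℕ ↦ (n.divisors.card : ℝ) ^ 2 / (n : ℝ) ^ c := by
  have hz : LSeriesSummable (fun n ↦ (ζ : ArithmeticFunction ℂ) n) (c : ℂ) :=
    LSeriesSummable_zeta_iff.2 (by simpa using hc)
  have h2 := LSeriesSummable_mul hz hz
  have h4 := (LSeriesSummable_mul h2 h2).norm
  refine Summable.of_nonneg_of_le (fun n ↦ by positivity) (fun n ↦ ?_) h4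
  rcases eq_or_ne n 0 with rfl | hn
  · simp
  rw [LSeries.norm_term_eq, if_neg hn, Complex.ofReal_re]
  gcongr
  have hd (m : ℕ) : ((ζ : ArithmeticFunction ℂ) * ζ) m = (m.divisors.card : ℂ) := by
    rw [coe_zeta_mul_apply, Finset.sum_congr rfl (g := fun _ ↦ (1 : ℂ))]
    · simp
    · intro i hi
      simp [(Nat.pos_of_mem_divisors hi).ne']
  rw [mul_apply]
  simp_rw [hd]
  norm_cast
  exact sq_card_divisors_le n

lemma summable_sq_mul_rpow {lam : ℕ → ℝ}
    (hlam : ∀ n : ℕ, 0 < n → |lam n| ≤ (n.divisors.card : ℝ)) {c : ℝ} (hc : 1 < c) :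
    Summable fun n : ℕ+ ↦ lam n ^ 2 / ((n : ℕ) : ℝ) ^ c := by
  refine Summable.of_nonneg_of_le (fun n ↦ by positivity) (fun n ↦ ?_)
    ((summable_sq_card_divisors hc).comp_injective PNat.coe_injective)
  dsimp only [Function.comp]
  gcongr ?_ / _
  exact sq_le_sq' (abs_le.1 (hlam n n.pos)).1 (abs_le.1 (hlam n n.pos)).2

lemma norm_Dser_term (lam : ℕ → ℝ) (n : ℕ+) (s : ℂ) :
    ‖(((lam n)^2 : ℝ) : ℂ) / ((n : ℕ) : ℂ) ^ s‖ = lam n ^ 2 / ((n : ℕ) : ℝ) ^ s.re := by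
  rw [norm_div, Complex.norm_natCast_cpow_of_pos n.pos, Complex.norm_real, Real.norm_of_nonneg
    (by positivity)]

lemma norm_Dser_term_le (lam : ℕ → ℝ) {c : ℝ} (n : ℕ+) {s : ℂ} (hs : c ≤ s.re) :
    ‖(((lam n)^2 : ℝ) : ℂ) / ((n : ℕ) : ℂ) ^ s‖ ≤ lam n ^ 2 / ((n : ℕ) : ℝ) ^ c := by
  rw [norm_Dser_term]
  have : (1 : ℝ) ≤ (n : ℕ) := mod_cast n.pos
  gcongr

lemma differentiableOn_Dser {lam : ℕ → ℝ}
    (hlam : ∀ n : ℕ, 0 < n → |lam n| ≤ (n.divisors.card : ℝ)) {c : ℝ} (hc : 1 < c) :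
    DifferentiableOn ℂ (Dser lam) {s | c < s.re} := by
  refine Complex.differentiableOn_tsum_of_summable_norm (summable_sq_mul_rpow hlam hc) (fun n ↦ ?_)
    (isOpen_lt continuous_const Complex.continuous_re) fun n s hs ↦ norm_Dser_term_le lam n hs.le
  intro s _
  have : ((n : ℕ) : ℂ) ≠ 0 := by simp
  refine DifferentiableAt.differentiableWithinAt ?_
  exact (differentiableAt_const _).div (differentiableAt_id.const_cpow (Or.inl this))
    (by simp [Complex.cpow_eq_zero_iff])

lemma norm_Dser_le {lam : ℕ → ℝ}
    (hlam : ∀ n : ℕ, 0 < n → |lam n| ≤ (n.divisors.card : ℝ)) {c : ℝ} (hc : 1 < c)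
    {s : ℂ} (hs : c ≤ s.re) : ‖Dser lam s‖ ≤ ∑' n : ℕ+, lam n ^ 2 / ((n : ℕ) : ℝ) ^ c :=
  tsum_of_norm_bounded (summable_sq_mul_rpow hlam hc).hasSum fun n ↦ norm_Dser_term_le lam n hs

lemma norm_cpow_mul_cpow_one_sub (u v : ℂ) {x : ℝ} (hx : x ∈ Set.Ioo (0 : ℝ) 1) :
    ‖(x : ℂ) ^ (u - 1) * (1 - (x : ℂ)) ^ (v - 1)‖ = x ^ (u.re - 1) * (1 - x) ^ (v.re - 1) := by
  have h1 : (1 : ℂ) - (x : ℂ) = ((1 - x : ℝ) : ℂ) := by push_cast; rfl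
  rw [norm_mul, h1, Complex.norm_cpow_eq_rpow_re_of_pos hx.1,
    Complex.norm_cpow_eq_rpow_re_of_pos (sub_pos.2 hx.2)]
  simp

lemma betaIntegral_eq_setIntegral_Ioo (u v : ℂ) :
    Complex.betaIntegral u v =
      ∫ x in Set.Ioo (0 : ℝ) 1, (x : ℂ) ^ (u - 1) * (1 - (x : ℂ)) ^ (v - 1) := by
  rw [Complex.betaIntegral, intervalIntegral.integral_of_le zero_le_one, integral_Ioc_eq_integral_Ioo]

lemma setIntegral_rpow_mul_rpow_one_sub {a b : ℝ} (ha : 0 < a) (hb : 0 < b) :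
    ∫ x in Set.Ioo (0 : ℝ) 1, x ^ (a - 1) * (1 - x) ^ (b - 1) = ProbabilityTheory.beta a b := by
  rw [ProbabilityTheory.beta_eq_betaIntegralReal a b ha hb, betaIntegral_eq_setIntegral_Ioo,
    ← Complex.ofReal_re (∫ x in Set.Ioo (0 : ℝ) 1, x ^ (a - 1) * (1 - x) ^ (b - 1)),
    ← integral_complex_ofReal]
  congr 1
  refine setIntegral_congr_fun measurableSet_Ioo fun x hx ↦ ?_
  simp only [Complex.ofReal_mul, Complex.ofReal_cpow hx.1.le,
    Complex.ofReal_cpow (sub_nonneg.2 hx.2.le)]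
  push_cast
  rfl

lemma integrableOn_cpow_mul_cpow_one_sub {u v : ℂ} (hu : 0 < u.re) (hv : 0 < v.re) :
    IntegrableOn (fun x : ℝ ↦ (x : ℂ) ^ (u - 1) * (1 - (x : ℂ)) ^ (v - 1)) (Set.Ioo 0 1) :=
  ((intervalIntegrable_iff_integrableOn_Ioc_of_le zero_le_one).1
    (Complex.betaIntegral_convergent hu hv)).mono_set Set.Ioo_subset_Ioc_self

lemma integral_norm_cpow_mul_cpow_one_sub {u v : ℂ} (hu : 0 < u.re) (hv : 0 < v.re) :
    ∫ x in Set.Ioo (0 : ℝ) 1, ‖(x : ℂ) ^ (u - 1) * (1 - (x : ℂ)) ^ (v - 1)‖ =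
      ProbabilityTheory.beta u.re v.re := by
  rw [← setIntegral_rpow_mul_rpow_one_sub hu hv]
  exact setIntegral_congr_fun measurableSet_Ioo fun x hx ↦ norm_cpow_mul_cpow_one_sub u v hx

lemma norm_betaIntegral_le {u v : ℂ} (hu : 0 < u.re) (hv : 0 < v.re) :
    ‖Complex.betaIntegral u v‖ ≤ ProbabilityTheory.beta u.re v.re := by
  rw [betaIntegral_eq_setIntegral_Ioo, ← integral_norm_cpow_mul_cpow_one_sub hu hv]
  exact norm_integral_le_integral_norm _

lemma norm_Gamma_le_Gamma_re {s : ℂ} (hs : 0 < s.re) : ‖Complex.Gamma s‖ ≤ Real.Gamma s.re := by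
  rw [Complex.Gamma_eq_integral hs, Real.Gamma_eq_integral hs, Complex.GammaIntegral]
  refine (norm_integral_le_integral_norm _).trans_eq
    (setIntegral_congr_fun measurableSet_Ioi fun x hx ↦ ?_)
  rw [norm_mul, Complex.norm_cpow_eq_rpow_re_of_pos hx]
  simp [Complex.norm_exp]

/-- Shifting the argument of `Γ` by a positive real number. -/
lemma norm_Gamma_le_mul_norm_Gamma_add {u : ℂ} {v : ℝ} (hu : 0 < u.re) (hv : 0 < v) :
    ‖Complex.Gamma u‖ ≤ Real.Gamma u.re / Real.Gamma (u.re + v) * ‖Complex.Gamma (u + v)‖ := by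
  have h := congrArg norm (Complex.Gamma_mul_Gamma_eq_betaIntegral hu
    (show 0 < (v : ℂ).re by simpa using hv))
  have hb := norm_betaIntegral_le hu (show 0 < (v : ℂ).re by simpa using hv)
  have hG := Real.Gamma_pos_of_pos hv
  rw [norm_mul, norm_mul, Complex.Gamma_ofReal, Complex.norm_real, Real.norm_of_nonneg hG.le] at h
  rw [Complex.ofReal_re, ProbabilityTheory.beta] at hb
  have h2 : ‖Complex.Gamma u‖ * Real.Gamma v ≤
      Real.Gamma u.re / Real.Gamma (u.re + v) * ‖Complex.Gamma (u + v)‖ * Real.Gamma v := by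
    rw [h]
    calc _ ≤ ‖Complex.Gamma (u + v)‖ *
          (Real.Gamma u.re * Real.Gamma v / Real.Gamma (u.re + v)) := by gcongr
      _ = _ := by ring
  exact le_of_mul_le_mul_right h2 hG

lemma Gamma_add_nat {p : ℂ} (hp : 0 < p.re) (n : ℕ) :
    Complex.Gamma (p + n) = (ascPochhammer ℂ n).eval p * Complex.Gamma p := by
  rw [← Complex.Gamma_add_nat_div_Gamma_eq p, div_mul_cancel₀ _ (Complex.Gamma_ne_zero_of_re_pos hp)]
  rintro k rfl
  simp at hp
  linarith [k.cast_nonneg (α := ℝ)]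

lemma norm_pow_mul_norm_Gamma_le {w : ℂ} (hw : 0 < w.re) (n : ℕ) :
    ‖w‖ ^ n * ‖Complex.Gamma w‖ ≤ Real.Gamma (w.re + n) := by
  have h : ‖w‖ ^ n ≤ ‖(ascPochhammer ℂ n).eval w‖ := by
    induction n with
    | zero => simp
    | succ n ih =>
      rw [ascPochhammer_succ_eval, norm_mul, pow_succ]
      gcongr
      rw [Complex.norm_def, Complex.norm_def]
      apply Real.sqrt_le_sqrt
      simp only [Complex.normSq_apply, Complex.add_re, Complex.natCast_re, Complex.add_im,
        Complex.natCast_im, add_zero]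
      gcongr <;> simp
  calc _ ≤ ‖(ascPochhammer ℂ n).eval w‖ * ‖Complex.Gamma w‖ := by gcongr
    _ = ‖Complex.Gamma (w + n)‖ := by rw [Gamma_add_nat hw, norm_mul]
    _ ≤ _ := by
      convert norm_Gamma_le_Gamma_re (s := w + n) ?_ using 1
      · simp
      · simp; positivity

lemma norm_sq_eq_re_sq_add_im_sq (w : ℂ) : ‖w‖ ^ 2 = w.re ^ 2 + w.im ^ 2 := by
  rw [Complex.sq_norm, Complex.normSq_apply]; ring

lemma norm_Gamma_shift_le {k : ℕ} (hk : 2 ≤ k) {s : ℂ} (h1 : 5/4 ≤ s.re) (h2 : s.re ≤ 7/4) :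
    ‖Complex.Gamma (s + k - 1)‖ ≤ Real.Gamma (k + 9) / (1 + s.im ^ 2) ^ 4 := by
  have hk' : (2 : ℝ) ≤ k := mod_cast hk
  set w : ℂ := s + k - 1 with hw
  have hre : w.re = s.re + k - 1 := by simp [hw]
  have him : w.im = s.im := by simp [hw]
  have hb := norm_pow_mul_norm_Gamma_le (w := w) (by linarith) 8
  have hmono : Real.Gamma (w.re + (8 : ℕ)) ≤ Real.Gamma (k + 9) := by
    refine Real.Gamma_strictMonoOn_Ici.monotoneOn ?_ ?_ ?_ <;>
    · try simp only [Set.mem_Ici]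
      push_cast
      linarith
  have hn : (1 + s.im ^ 2) ^ 4 ≤ ‖w‖ ^ 8 := by
    rw [show ‖w‖ ^ 8 = (‖w‖ ^ 2) ^ 4 by ring, norm_sq_eq_re_sq_add_im_sq, him]
    gcongr
    nlinarith
  rw [le_div_iff₀ (by positivity), mul_comm]
  exact (mul_le_mul_of_nonneg_right hn (norm_nonneg _)).trans (hb.trans hmono)

lemma Gamma_le_five {x : ℝ} (h1 : 3/4 ≤ x) (h2 : x ≤ 5/4) : Real.Gamma x ≤ 5 := by
  have h : Real.Gamma (x + 2) = (x + 1) * (x * Real.Gamma x) := by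
    rw [← Real.Gamma_add_one (by linarith), ← Real.Gamma_add_one (by linarith)]
    ring_nf
  have h4 : Real.Gamma (x + 2) ≤ Real.Gamma 4 :=
    Real.Gamma_strictMonoOn_Ici.monotoneOn (by simp; linarith) (by norm_num) (by linarith)
  have h5 : Real.Gamma 4 = 6 := by
    rw [show (4 : ℝ) = (3 : ℕ) + 1 by norm_num, Real.Gamma_nat_eq_factorial]
    norm_num [Nat.factorial]
  have hG := Real.Gamma_pos_of_pos (show 0 < x by linarith)
  have : 21/16 ≤ (x + 1) * x := by nlinarith
  nlinarith

lemma norm_Gamma_mul_inv_Gamma_le {s : ℂ} (h1 : 5/4 ≤ s.re) (h2 : s.re ≤ 7/4) :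
    ‖Complex.Gamma (s - 1/2) * (Complex.Gamma (2 - s))⁻¹‖ ≤ 10 * (1 + s.im ^ 2) := by
  have hpos : 0 < ‖Complex.Gamma (2 - s)‖ :=
    norm_pos_iff.2 (Complex.Gamma_ne_zero_of_re_pos (by simp; linarith))
  rw [norm_mul, norm_inv, ← div_eq_mul_inv, div_le_iff₀ hpos]
  have hre : (s - 1/2 : ℂ).re = s.re - 1/2 := by simp
  have hconj : (s - 1/2 : ℂ) + ((9/2 - 2 * s.re : ℝ) : ℂ) = (starRingEnd ℂ) (4 - s) := by
    apply Complex.ext <;> simp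
    ring
  have hrec : Complex.Gamma (4 - s) = (3 - s) * ((2 - s) * Complex.Gamma (2 - s)) := by
    rw [← Complex.Gamma_add_one (2 - s), show (2 - s + 1 : ℂ) = 3 - s by ring,
      ← Complex.Gamma_add_one (3 - s)]
    · ring_nf
    · intro h; have := congrArg Complex.re h; simp at this; linarith
    · intro h; have := congrArg Complex.re h; simp at this; linarith
  have h := norm_Gamma_le_mul_norm_Gamma_add (u := s - 1/2) (v := 9/2 - 2 * s.re)
    (by rw [hre]; linarith) (by linarith)
  rw [hconj, Complex.Gamma_conj, Complex.norm_conj, hrec, norm_mul, norm_mul, hre] at h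
  have hA : Real.Gamma (s.re - 1/2) / Real.Gamma (s.re - 1/2 + (9/2 - 2 * s.re)) ≤ 5 := by
    have hone : 1 ≤ Real.Gamma (s.re - 1/2 + (9/2 - 2 * s.re)) := by
      refine Real.Gamma_two.ge.trans ?_
      exact Real.Gamma_strictMonoOn_Ici.monotoneOn (by simp) (by simp; linarith) (by linarith)
    rw [div_le_iff₀ (by linarith)]
    linarith [Gamma_le_five (x := s.re - 1/2) (by linarith) (by linarith)]
  have h3 : ‖3 - s‖ * ‖2 - s‖ ≤ 2 * (1 + s.im ^ 2) := by
    have e3 : ‖3 - s‖ ^ 2 ≤ 4 * (1 + s.im ^ 2) := by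
      rw [norm_sq_eq_re_sq_add_im_sq]; simp; nlinarith [sq_nonneg s.im]
    have e2 : ‖2 - s‖ ^ 2 ≤ 1 * (1 + s.im ^ 2) := by
      rw [norm_sq_eq_re_sq_add_im_sq]
      simp only [Complex.sub_re, Complex.sub_im, Complex.re_ofNat, Complex.im_ofNat]
      nlinarith
    refine abs_le_of_sq_le_sq' ?_ (by positivity) |>.2
    rw [mul_pow, mul_pow]
    nlinarith [mul_le_mul e3 e2 (by positivity) (by positivity)]
  calc _ ≤ _ := h
    _ ≤ 5 * (‖3 - s‖ * (‖2 - s‖ * ‖Complex.Gamma (2 - s)‖)) := by gcongr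
    _ = 5 * (‖3 - s‖ * ‖2 - s‖) * ‖Complex.Gamma (2 - s)‖ := by ring
    _ ≤ 5 * (2 * (1 + s.im ^ 2)) * ‖Complex.Gamma (2 - s)‖ := by gcongr
    _ = _ := by ring

/-- The series `Q(p,z) = ∑ (p)_m / (2p)_m (-z)^m / (m+1)!`, which is regular in `Re p > 0` and
satisfies `₁F₁(p-1, 2p-1, -z) = 1 - (p-1)/(2p-1) z Q(p,z)`. -/
noncomputable def confluentTail (p : ℂ) (z : ℝ) : ℂ :=
  ∑' m : ℕ, (ascPochhammer ℂ m).eval p / (ascPochhammer ℂ m).eval (2 * p) *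
    ((((-z) ^ m / (m + 1).factorial : ℝ)) : ℂ)

lemma norm_ascPochhammer_div_le_one {p : ℂ} (hp : 0 < p.re) (m : ℕ) :
    ‖(ascPochhammer ℂ m).eval p / (ascPochhammer ℂ m).eval (2 * p)‖ ≤ 1 := by
  rw [norm_div]
  refine div_le_one_of_le₀ ?_ (norm_nonneg _)
  induction m with
  | zero => simp
  | succ m ih =>
    rw [ascPochhammer_succ_eval, ascPochhammer_succ_eval, norm_mul, norm_mul]
    gcongr
    rw [← abs_of_nonneg (norm_nonneg (p + m)), ← abs_of_nonneg (norm_nonneg (2 * p + m)),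
      ← sq_le_sq, norm_sq_eq_re_sq_add_im_sq, norm_sq_eq_re_sq_add_im_sq]
    have hm : (0 : ℝ) ≤ m := m.cast_nonneg
    simp only [Complex.add_re, Complex.natCast_re, Complex.add_im, Complex.natCast_im,
      Complex.mul_re, Complex.mul_im, Complex.re_ofNat, Complex.im_ofNat]
    nlinarith [sq_nonneg p.im, mul_nonneg hm hp.le]

lemma ascPochhammer_eval_ne_zero {w : ℂ} (hw : 0 < w.re) (m : ℕ) :
    (ascPochhammer ℂ m).eval w ≠ 0 := by
  intro h
  have := Gamma_add_nat hw m
  rw [h, zero_mul] at this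
  refine Complex.Gamma_ne_zero_of_re_pos ?_ this
  simp
  positivity

lemma norm_confluentTail_term_le {p : ℂ} (hp : 0 < p.re) {z : ℝ} (hz : 0 ≤ z) (m : ℕ) :
    ‖(ascPochhammer ℂ m).eval p / (ascPochhammer ℂ m).eval (2 * p) *
      ((((-z) ^ m / (m + 1).factorial : ℝ)) : ℂ)‖ ≤ z ^ m / m.factorial := by
  rw [norm_mul, Complex.norm_real, norm_div (_ : ℝ), norm_pow, norm_neg, Real.norm_of_nonneg hz,
    Real.norm_of_nonneg (Nat.cast_nonneg _)]
  refine (mul_le_of_le_one_left (by positivity) (norm_ascPochhammer_div_le_one hp m)).trans ?_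
  gcongr
  exact m.le_succ

lemma summable_confluentTail {p : ℂ} (hp : 0 < p.re) {z : ℝ} (hz : 0 ≤ z) :
    Summable fun m : ℕ ↦ (ascPochhammer ℂ m).eval p / (ascPochhammer ℂ m).eval (2 * p) *
      ((((-z) ^ m / (m + 1).factorial : ℝ)) : ℂ) :=
  .of_norm_bounded (Real.summable_pow_div_factorial z) (norm_confluentTail_term_le hp hz)

lemma norm_confluentTail_le_exp {p : ℂ} (hp : 0 < p.re) {z : ℝ} (hz : 0 ≤ z) :
    ‖confluentTail p z‖ ≤ Real.exp z := by
  refine tsum_of_norm_bounded ?_ (norm_confluentTail_term_le hp hz)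
  rw [Real.exp_eq_exp_ℝ]
  exact NormedSpace.expSeries_div_hasSum_exp z

lemma differentiableOn_confluentTail {z : ℝ} (hz : 0 ≤ z) :
    DifferentiableOn ℂ (fun p ↦ confluentTail p z) {p | 0 < p.re} := by
  refine Complex.differentiableOn_tsum_of_summable_norm (Real.summable_pow_div_factorial z)
    (fun m ↦ ?_) (isOpen_lt continuous_const Complex.continuous_re)
    fun m p hp ↦ norm_confluentTail_term_le hp hz m
  intro p hp
  refine DifferentiableAt.differentiableWithinAt (DifferentiableAt.mul_const (.div ?_ ?_ ?_) _)
  · exact (ascPochhammer ℂ m).differentiable p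
  · exact ((ascPochhammer ℂ m).differentiable _).comp p (differentiableAt_id.const_mul _)
  · refine ascPochhammer_eval_ne_zero ?_ m
    have : 0 < p.re := hp
    simpa using this

lemma oneF1_eq {p : ℂ} (hp : 0 < p.re) {z : ℝ} (hz : 0 ≤ z) :
    oneF1 (p - 1) (2 * p - 1) ((-z : ℝ) : ℂ) =
      1 - (p - 1) / (2 * p - 1) * z * confluentTail p z := by
  have hasc (a : ℂ) (m : ℕ) : (ascPochhammer ℂ (m + 1)).eval (a - 1) =
      (a - 1) * (ascPochhammer ℂ m).eval a := by
    rw [ascPochhammer_succ_left]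
    simp
  have hterm (m : ℕ) : (ascPochhammer ℂ (m + 1)).eval (p - 1) * ((-z : ℝ) : ℂ) ^ (m + 1) /
      ((ascPochhammer ℂ (m + 1)).eval (2 * p - 1) * ((m + 1).factorial : ℂ)) =
      -((p - 1) / (2 * p - 1) * z) * ((ascPochhammer ℂ m).eval p / (ascPochhammer ℂ m).eval (2 * p) *
        ((((-z) ^ m / (m + 1).factorial : ℝ)) : ℂ)) := by
    rw [hasc, hasc]
    push_cast
    simp only [div_eq_mul_inv, mul_inv]
    ring
  have hs := summable_confluentTail hp hz
  rw [oneF1, Summable.tsum_eq_zero_add]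
  · simp_rw [hterm]
    rw [tsum_mul_left, ← confluentTail]
    simp
    ring
  · rw [← summable_nat_add_iff 1]
    simp_rw [hterm]
    exact hs.mul_left _

lemma norm_tsum_neg_pow_div_factorial_le {x : ℝ} (hx : 0 < x) :
    ‖∑' m : ℕ, ((((-x) ^ m / (m + 1).factorial : ℝ)) : ℂ)‖ ≤ 1 := by
  have h : HasSum (fun m : ℕ ↦ (-x) ^ m / (m + 1).factorial) ((1 - Real.exp (-x)) / x) := by
    have h0 : HasSum (fun m : ℕ ↦ (-x) ^ m / m.factorial) (Real.exp (-x)) := by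
      rw [Real.exp_eq_exp_ℝ]
      exact NormedSpace.expSeries_div_hasSum_exp (-x)
    have h1 := ((hasSum_nat_add_iff' 1).2 h0).mul_left (-x⁻¹)
    have he : (1 - Real.exp (-x)) / x =
        -x⁻¹ * (Real.exp (-x) - ∑ i ∈ Finset.range 1, (-x) ^ i / i.factorial) := by
      simp
      field_simp
      ring
    rw [he]
    refine h1.congr_fun fun m ↦ ?_
    rw [pow_succ]
    field_simp
  rw [← Complex.ofReal_tsum, h.tsum_eq, Complex.norm_real, Real.norm_eq_abs, abs_le]
  have h1 : Real.exp (-x) ≤ 1 := Real.exp_le_one_iff.2 (by linarith)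
  have h2 := Real.add_one_le_exp (-x)
  constructor
  · have : 0 ≤ (1 - Real.exp (-x)) / x := div_nonneg (by linarith) hx.le
    linarith
  · rw [div_le_one hx]; linarith

lemma betaIntegral_add_nat {p : ℂ} (hp : 0 < p.re) (m : ℕ) :
    Complex.betaIntegral (p + m) p = (ascPochhammer ℂ m).eval p /
      (ascPochhammer ℂ m).eval (2 * p) * Complex.betaIntegral p p := by
  have h2 : 0 < (2 * p).re := by simpa using hp
  have hpm : 0 < (p + m).re := by simp; positivity
  rw [Complex.betaIntegral_eq_Gamma_mul_div _ _ hpm hp, Complex.betaIntegral_eq_Gamma_mul_div _ _ hp hp,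
    show p + m + p = 2 * p + m by ring, ← two_mul, Gamma_add_nat hp, Gamma_add_nat h2]
  have := ascPochhammer_eval_ne_zero h2 m
  have := Complex.Gamma_ne_zero_of_re_pos h2
  field_simp

lemma norm_confluentTail_mul_betaIntegral_le {p : ℂ} (hp : 0 < p.re) {z : ℝ} (hz : 0 < z) :
    ‖confluentTail p z‖ * ‖Complex.betaIntegral p p‖ ≤ ProbabilityTheory.beta p.re p.re := by
  set b : ℝ → ℂ := fun x ↦ (x : ℂ) ^ (p - 1) * (1 - (x : ℂ)) ^ (p - 1) with hb
  have hbi : IntegrableOn b (Set.Ioo 0 1) := integrableOn_cpow_mul_cpow_one_sub hp hp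
  set F : ℕ → ℝ → ℂ := fun m x ↦ ((((-(z * x)) ^ m / (m + 1).factorial : ℝ)) : ℂ) * b x with hF
  have hFle (m : ℕ) {x : ℝ} (hx : x ∈ Set.Ioo (0 : ℝ) 1) :
      ‖F m x‖ ≤ z ^ m / m.factorial * ‖b x‖ := by
    have hzx : 0 ≤ z * x := mul_nonneg hz.le hx.1.le
    simp only [hF]
    rw [norm_mul, Complex.norm_real, norm_div, norm_pow, norm_neg, Real.norm_of_nonneg hzx,
      Real.norm_of_nonneg (Nat.cast_nonneg _)]
    gcongr
    · exact mul_le_of_le_one_right hz.le hx.2.le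
    · exact m.le_succ
  have hFi (m : ℕ) : IntegrableOn (F m) (Set.Ioo 0 1) := by
    refine Integrable.mono' (hbi.norm.const_mul (z ^ m / m.factorial)) ?_ ?_
    · refine AEStronglyMeasurable.mul ?_ hbi.aestronglyMeasurable
      exact Continuous.aestronglyMeasurable (by fun_prop)
    · exact (ae_restrict_iff' measurableSet_Ioo).2 (.of_forall fun x hx ↦ hFle m hx)
  have hsum : Summable fun m ↦ ∫ x in Set.Ioo (0 : ℝ) 1, ‖F m x‖ := by
    refine Summable.of_nonneg_of_le (fun m ↦ by positivity) (fun m ↦ ?_)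
      ((Real.summable_pow_div_factorial z).mul_right (∫ x in Set.Ioo (0 : ℝ) 1, ‖b x‖))
    rw [← integral_const_mul]
    exact setIntegral_mono_on (hFi m).norm (hbi.norm.const_mul _) measurableSet_Ioo
      fun x hx ↦ hFle m hx
  have hint (m : ℕ) : ∫ x in Set.Ioo (0 : ℝ) 1, F m x =
      (ascPochhammer ℂ m).eval p / (ascPochhammer ℂ m).eval (2 * p) *
        ((((-z) ^ m / (m + 1).factorial : ℝ)) : ℂ) * Complex.betaIntegral p p := by
    rw [mul_right_comm, ← betaIntegral_add_nat hp, betaIntegral_eq_setIntegral_Ioo, mul_comm,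
      ← integral_const_mul]
    refine setIntegral_congr_fun measurableSet_Ioo fun x hx ↦ ?_
    have hx0 : (x : ℂ) ≠ 0 := by exact_mod_cast hx.1.ne'
    simp only [hF, hb]
    rw [show p + m - 1 = p - 1 + m by ring, Complex.cpow_add _ _ hx0, Complex.cpow_natCast]
    push_cast
    rw [neg_mul_eq_neg_mul, mul_pow]
    ring
  have hs := hasSum_integral_of_summable_integral_norm hFi hsum
  simp_rw [hint] at hs
  have hkey := hs.unique ((summable_confluentTail hp hz.le).hasSum.mul_right _)
  rw [← confluentTail] at hkey
  rw [← norm_mul, ← hkey, ← integral_norm_cpow_mul_cpow_one_sub hp hp]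
  refine norm_integral_le_of_norm_le hbi.norm
    ((ae_restrict_iff' measurableSet_Ioo).2 (.of_forall fun x hx ↦ ?_))
  simp only [hF]
  rw [tsum_mul_right, norm_mul]
  exact mul_le_of_le_one_left (norm_nonneg _)
    (norm_tsum_neg_pow_div_factorial_le (mul_pos hz hx.1))

lemma norm_Gamma_two_mul_le {p : ℂ} (hp : 0 < p.re) (hp2 : p.re ≤ 1/2) :
    ‖Complex.Gamma (2 * p)‖ ≤
      Real.Gamma (p.re + 1/2) / Real.Gamma (p.re + 1) * ‖p‖ * ‖Complex.Gamma p‖ ^ 2 := by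
  have h := congrArg norm (Complex.Gamma_mul_Gamma_add_half p)
  rw [norm_mul, norm_mul, norm_mul, Complex.norm_real,
    show (2 : ℂ) = ((2 : ℝ) : ℂ) by norm_num, Complex.norm_cpow_eq_rpow_re_of_pos two_pos,
    Real.norm_of_nonneg (Real.sqrt_nonneg _)] at h
  have h1 : 1 ≤ (2 : ℝ) ^ ((1 - ((2 : ℝ) : ℂ) * p).re) :=
    Real.one_le_rpow one_le_two (by simp; linarith)
  have h2 : 1 ≤ √π := Real.one_le_sqrt.2 (by linarith [Real.pi_gt_three])
  have h3 := norm_Gamma_le_mul_norm_Gamma_add (u := p + 1/2) (v := 1/2)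
    (by simp; linarith) (by norm_num)
  have hre : (p + 1/2 : ℂ).re = p.re + 1/2 := by simp
  have hp0 : p ≠ 0 := by rintro rfl; simp at hp
  rw [hre, show p + 1/2 + ((1/2 : ℝ) : ℂ) = p + 1 by push_cast; ring, Complex.Gamma_add_one p hp0,
    norm_mul, show p.re + 1/2 + 1/2 = p.re + 1 by ring] at h3
  push_cast at h h1
  calc ‖Complex.Gamma (2 * p)‖ ≤ ‖Complex.Gamma (2 * p)‖ * 2 ^ (1 - 2 * p).re * √π := by
        rw [mul_assoc]
        exact le_mul_of_one_le_right (norm_nonneg _) (one_le_mul_of_one_le_of_one_le h1 h2)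
    _ = ‖Complex.Gamma p‖ * ‖Complex.Gamma (p + 1/2)‖ := h.symm
    _ ≤ ‖Complex.Gamma p‖ * (Real.Gamma (p.re + 1/2) / Real.Gamma (p.re + 1) *
        (‖p‖ * ‖Complex.Gamma p‖)) := by gcongr
    _ = _ := by ring

lemma norm_confluentTail_le {p : ℂ} (hp : 0 < p.re) (hp2 : p.re ≤ 1/2) {z : ℝ} (hz : 0 < z) :
    ‖confluentTail p z‖ ≤ ProbabilityTheory.beta p.re p.re *
      (Real.Gamma (p.re + 1/2) / Real.Gamma (p.re + 1)) * ‖p‖ := by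
  have h := norm_confluentTail_mul_betaIntegral_le hp hz
  have hG : 0 < ‖Complex.Gamma p‖ := norm_pos_iff.2 (Complex.Gamma_ne_zero_of_re_pos hp)
  have hG2 : 0 < ‖Complex.Gamma (2 * p)‖ :=
    norm_pos_iff.2 (Complex.Gamma_ne_zero_of_re_pos (by simpa using hp))
  rw [Complex.betaIntegral_eq_Gamma_mul_div _ _ hp hp, ← two_mul, norm_div, norm_mul, ← sq,
    ← mul_div_assoc, div_le_iff₀ hG2] at h
  refine le_of_mul_le_mul_right ?_ (pow_pos hG 2)
  refine h.trans ?_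
  have hb := (ProbabilityTheory.beta_pos hp hp).le
  calc _ ≤ ProbabilityTheory.beta p.re p.re * _ :=
        mul_le_mul_of_nonneg_left (norm_Gamma_two_mul_le hp hp2) hb
    _ = _ := by ring

lemma isOpen_strip (a b : ℝ) : IsOpen {s : ℂ | a < s.re ∧ s.re < b} :=
  (isOpen_lt continuous_const Complex.continuous_re).inter
    (isOpen_lt Complex.continuous_re continuous_const)

lemma continuous_comp_vertical {f : ℂ → ℂ} {a b x : ℝ}
    (hf : DifferentiableOn ℂ f {s | a < s.re ∧ s.re < b}) (ha : a < x) (hb : x < b) :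
    Continuous fun t : ℝ ↦ f (x + t * Complex.I) :=
  hf.continuousOn.comp_continuous (by fun_prop) fun t ↦ by simp [ha, hb]

lemma integrable_of_norm_le_inv {f : ℝ → ℂ} {M : ℝ} (hf : Continuous f)
    (h : ∀ t, ‖f t‖ ≤ M / (1 + t ^ 2)) : Integrable f :=
  .mono' (integrable_inv_one_add_sq.const_mul M) hf.aestronglyMeasurable
    (.of_forall fun t ↦ by simpa [div_eq_mul_inv] using h t)

lemma norm_integral_le_mul_pi {f : ℝ → ℂ} {M : ℝ} (h : ∀ t, ‖f t‖ ≤ M / (1 + t ^ 2)) :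
    ‖∫ t, f t‖ ≤ M * π := by
  rw [← integral_univ_inv_one_add_sq, ← integral_const_mul]
  exact norm_integral_le_of_norm_le (integrable_inv_one_add_sq.const_mul M)
    (.of_forall fun t ↦ by simpa [div_eq_mul_inv] using h t)

/-- Moving a vertical line of integration within a strip of holomorphy. -/
lemma integral_vertical_eq {G : ℂ → ℂ} {a b x₁ x₂ M : ℝ} (ha : a < x₁) (h12 : x₁ ≤ x₂) (hb : x₂ < b)
    (hG : DifferentiableOn ℂ G {s | a < s.re ∧ s.re < b})
    (h₁ : Integrable fun t : ℝ ↦ G (x₁ + t * Complex.I))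
    (h₂ : Integrable fun t : ℝ ↦ G (x₂ + t * Complex.I))
    (hM : ∀ s : ℂ, x₁ ≤ s.re → s.re ≤ x₂ → 1 ≤ |s.im| → ‖G s‖ ≤ M / (1 + s.im ^ 2)) :
    ∫ t : ℝ, G (x₁ + t * Complex.I) = ∫ t : ℝ, G (x₂ + t * Complex.I) := by
  have hrect (T : ℝ) := Complex.integral_boundary_rect_eq_zero_of_differentiableOn G
    (x₁ + (-T : ℝ) * Complex.I) (x₂ + T * Complex.I) (hG.mono fun s hs ↦ by
      have := hs.1
      simp [Set.uIcc_of_le h12] at this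
      exact ⟨ha.trans_le this.1, this.2.trans_lt hb⟩)
  simp only [Complex.add_re, Complex.ofReal_re, Complex.mul_re, Complex.I_re, mul_zero,
    Complex.ofReal_im, Complex.I_im, mul_one, sub_self, add_zero, Complex.add_im, Complex.mul_im,
    zero_add] at hrect
  have hdec : Tendsto (fun T : ℝ ↦ M / (1 + T ^ 2) * |x₂ - x₁|) atTop (𝓝 0) := by
    have : Tendsto (fun T : ℝ ↦ 1 + T ^ 2) atTop atTop :=
      tendsto_atTop_add_const_left _ _ (tendsto_pow_atTop two_ne_zero)
    simpa using (this.const_div_atTop M).mul_const |x₂ - x₁|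
  have hhor (σ : ℝ) (hσ : |σ| = 1) :
      Tendsto (fun T : ℝ ↦ ∫ x in x₁..x₂, G (x + (σ * T : ℝ) * Complex.I)) atTop (𝓝 0) := by
    refine squeeze_zero_norm' ?_ hdec
    filter_upwards [eventually_ge_atTop 1] with T hT
    refine intervalIntegral.norm_integral_le_of_norm_le_const fun x hx ↦ ?_
    rw [Set.uIoc_of_le h12] at hx
    have hs2 : σ ^ 2 = 1 := by rw [← sq_abs, hσ, one_pow]
    refine (hM _ ?_ ?_ ?_).trans_eq ?_
    · simpa using hx.1.le
    · simpa using hx.2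
    · simpa [abs_mul, hσ, abs_of_pos (zero_lt_one.trans_le hT)] using hT
    · simp [mul_pow, hs2]
  have hv₁ := intervalIntegral_tendsto_integral h₁ tendsto_neg_atTop_atBot tendsto_id
  have hv₂ := intervalIntegral_tendsto_integral h₂ tendsto_neg_atTop_atBot tendsto_id
  have hlim := (((hhor (-1) (by simp)).sub (hhor 1 (by simp))).add
    (hv₂.const_smul Complex.I)).sub (hv₁.const_smul Complex.I)
  simp only [neg_mul, one_mul, id] at hlim
  have h0 := tendsto_nhds_unique (hlim.congr hrect) tendsto_const_nhds
  have h1 : Complex.I * ((∫ t : ℝ, G (x₂ + t * Complex.I)) - ∫ t : ℝ, G (x₁ + t * Complex.I)) = 0 := by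
    simpa [mul_sub] using h0
  exact (sub_eq_zero.1 ((mul_eq_zero.1 h1).resolve_left Complex.I_ne_zero)).symm

lemma norm_four_div_le {s : ℂ} (h1 : 5/4 ≤ s.re) (h2 : s.re ≤ 7/4) :
    4 - (s - 3/2) ^ 2 ≠ 0 ∧ ‖4 / (4 - (s - 3/2) ^ 2)‖ ≤ 4 / (1 + s.im ^ 2) := by
  have hre : (4 - (s - 3/2) ^ 2).re = 4 - (s.re - 3/2) ^ 2 + s.im ^ 2 := by
    simp [sq]; ring
  have hn : 1 + s.im ^ 2 ≤ ‖4 - (s - 3/2) ^ 2‖ := by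
    refine le_trans ?_ (Complex.re_le_norm _)
    rw [hre]
    nlinarith
  have hpos : 0 < 1 + s.im ^ 2 := by positivity
  refine ⟨norm_pos_iff.1 (hpos.trans_le hn), ?_⟩
  rw [norm_div, Complex.norm_ofNat]
  gcongr

lemma norm_vertical_sub_ge {σ : ℝ} (hσ : |σ - 3/2| = 1/4) (t : ℝ) :
    1/4 ≤ ‖(σ + t * Complex.I - 3/2 : ℂ)‖ := by
  rw [← hσ]
  refine le_trans (le_of_eq ?_) (Complex.abs_re_le_norm _)
  simp

lemma norm_div_vertical_sub_le {σ : ℝ} (hσ : |σ - 3/2| = 1/4) {w : ℂ} {N t : ℝ}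
    (hw : ‖w‖ ≤ N / (1 + t ^ 2)) :
    ‖w / (σ + t * Complex.I - 3/2)‖ ≤ 4 * N / (1 + t ^ 2) := by
  have h := norm_vertical_sub_ge hσ t
  rw [norm_div, div_le_iff₀ (lt_of_lt_of_le (by norm_num) h)]
  have h0 := (norm_nonneg _).trans hw
  calc _ ≤ N / (1 + t ^ 2) := hw
    _ = 4 * (N / (1 + t ^ 2)) * (1/4) := by ring
    _ ≤ 4 * (N / (1 + t ^ 2)) * _ := mul_le_mul_of_nonneg_left h (by positivity)
    _ = _ := by ring

/-- Moving the line of integration from `Re s = 5/4` to `Re s = 7/4` across a simple pole at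
`s = 3/2`. -/
lemma norm_integral_le_of_simple_pole {H : ℂ → ℂ} {M : ℝ}
    (hH : DifferentiableOn ℂ H {s | 1 < s.re ∧ s.re < 2})
    (hM : ∀ s : ℂ, 5/4 ≤ s.re → s.re ≤ 7/4 → ‖H s‖ ≤ M / (1 + s.im ^ 2)) :
    ‖∫ t : ℝ, H ((5/4 : ℝ) + t * Complex.I) / ((5/4 : ℝ) + t * Complex.I - 3/2)‖ ≤
      ‖∫ t : ℝ, H ((7/4 : ℝ) + t * Complex.I) / ((7/4 : ℝ) + t * Complex.I - 3/2)‖ +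
        32 * π * ‖H (3/2)‖ := by
  set g : ℂ → ℂ := fun s ↦ 4 / (4 - (s - 3/2) ^ 2) with hg
  set A := H (3/2) with hA
  set H₂ : ℂ → ℂ := fun s ↦ H s - A * g s with hH₂
  set G := dslope H₂ (3/2) with hGdef
  have hU := isOpen_strip 1 2
  have hgd : DifferentiableOn ℂ g {s | 1 < s.re ∧ s.re < 2} := by
    intro s hs
    refine DifferentiableAt.differentiableWithinAt (.div (by fun_prop) (by fun_prop) ?_)
    intro h
    have hre := congrArg Complex.re h
    simp [sq] at hre
    nlinarith [mul_pos (sub_pos.2 hs.1) (sub_pos.2 hs.2), mul_self_nonneg s.im]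
  have hGd : DifferentiableOn ℂ G {s | 1 < s.re ∧ s.re < 2} :=
    (Complex.differentiableOn_dslope (hU.mem_nhds (by norm_num))).2 (hH.sub (hgd.const_mul A))
  have hGeq {s : ℂ} (hs : s ≠ 3/2) : G s = H s / (s - 3/2) - A * (g s / (s - 3/2)) := by
    rw [hGdef, dslope_of_ne _ hs, slope_def_field]
    have h0 : H₂ (3/2) = 0 := by simp [hH₂, hg, hA]
    rw [h0, sub_zero]
    simp only [hH₂]
    ring
  have hne {σ : ℝ} (hσ : |σ - 3/2| = 1/4) (t : ℝ) : (σ + t * Complex.I : ℂ) ≠ 3/2 := by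
    intro h
    have := norm_vertical_sub_ge hσ t
    rw [h] at this
    norm_num at this
  have hbd {σ : ℝ} (hσ : |σ - 3/2| = 1/4) (h1 : 5/4 ≤ σ) (h2 : σ ≤ 7/4) {f : ℂ → ℂ} {N : ℝ}
      (hf : ∀ s : ℂ, 5/4 ≤ s.re → s.re ≤ 7/4 → ‖f s‖ ≤ N / (1 + s.im ^ 2)) (t : ℝ) :
      ‖f (σ + t * Complex.I) / (σ + t * Complex.I - 3/2)‖ ≤ 4 * N / (1 + t ^ 2) := by
    have hf' := hf (σ + t * Complex.I) (by simpa using h1) (by simpa using h2)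
    simp only [Complex.add_im, Complex.ofReal_im, Complex.mul_im, Complex.ofReal_re, Complex.I_im,
      mul_one, Complex.I_re, mul_zero, add_zero, zero_add] at hf'
    exact norm_div_vertical_sub_le hσ hf'
  have hgb : ∀ s : ℂ, 5/4 ≤ s.re → s.re ≤ 7/4 → ‖g s‖ ≤ 4 / (1 + s.im ^ 2) :=
    fun s h1 h2 ↦ (norm_four_div_le h1 h2).2
  have hint {σ : ℝ} (hσ : |σ - 3/2| = 1/4) (h1 : 5/4 ≤ σ) (h2 : σ ≤ 7/4) {f : ℂ → ℂ} {N : ℝ}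
      (hf : ∀ s : ℂ, 5/4 ≤ s.re → s.re ≤ 7/4 → ‖f s‖ ≤ N / (1 + s.im ^ 2))
      (hfd : DifferentiableOn ℂ f {s | 1 < s.re ∧ s.re < 2}) :
      Integrable fun t : ℝ ↦ f (σ + t * Complex.I) / (σ + t * Complex.I - 3/2) := by
    refine integrable_of_norm_le_inv (Continuous.div ?_ (by fun_prop) ?_) (hbd hσ h1 h2 hf)
    · exact continuous_comp_vertical hfd (by linarith) (by linarith)
    · exact fun t ↦ sub_ne_zero.2 (hne hσ t)
  have hGline {σ : ℝ} (hσ : |σ - 3/2| = 1/4) :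
      (fun t : ℝ ↦ G (σ + t * Complex.I)) = fun t : ℝ ↦
        H (σ + t * Complex.I) / (σ + t * Complex.I - 3/2) -
          A * (g (σ + t * Complex.I) / (σ + t * Complex.I - 3/2)) :=
    funext fun t ↦ hGeq (hne hσ t)
  have hGi {σ : ℝ} (hσ : |σ - 3/2| = 1/4) (h1 : 5/4 ≤ σ) (h2 : σ ≤ 7/4) :
      Integrable fun t : ℝ ↦ G (σ + t * Complex.I) := by
    rw [hGline hσ]
    exact (hint hσ h1 h2 hM hH).sub ((hint hσ h1 h2 hgb hgd).const_mul A)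
  have hGint {σ : ℝ} (hσ : |σ - 3/2| = 1/4) (h1 : 5/4 ≤ σ) (h2 : σ ≤ 7/4) :
      ∫ t : ℝ, G (σ + t * Complex.I) =
        (∫ t : ℝ, H (σ + t * Complex.I) / (σ + t * Complex.I - 3/2)) -
          A * ∫ t : ℝ, g (σ + t * Complex.I) / (σ + t * Complex.I - 3/2) := by
    rw [hGline hσ, integral_sub (hint hσ h1 h2 hM hH) ((hint hσ h1 h2 hgb hgd).const_mul A),
      integral_const_mul]
  have hshift : ∫ t : ℝ, G ((5/4 : ℝ) + t * Complex.I) = ∫ t : ℝ, G ((7/4 : ℝ) + t * Complex.I) := by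
    refine integral_vertical_eq (M := M + ‖A‖ * 4) (by norm_num) (by norm_num) (by norm_num) hGd
      (hGi (by norm_num [abs_of_neg]) (by norm_num) (by norm_num))
      (hGi (by norm_num) (by norm_num) (by norm_num)) fun s h1 h2 h3 ↦ ?_
    have him : 1 ≤ ‖s - 3/2‖ := by
      refine h3.trans (le_trans (le_of_eq ?_) (Complex.abs_im_le_norm _))
      simp
    have hs : s ≠ 3/2 := by
      rintro rfl
      norm_num at him
    rw [hGeq hs, ← mul_div_assoc, ← sub_div, norm_div]
    refine (div_le_self (norm_nonneg _) him).trans ((norm_sub_le _ _).trans ?_)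
    rw [norm_mul, add_div, mul_div_assoc]
    gcongr
    · exact hM s h1 h2
    · exact hgb s h1 h2
  have h5 : |(5/4 : ℝ) - 3/2| = 1/4 := by norm_num [abs_of_neg]
  have h7 : |(7/4 : ℝ) - 3/2| = 1/4 := by norm_num
  rw [hGint h5 (by norm_num) (by norm_num), hGint h7 (by norm_num) (by norm_num),
    sub_eq_iff_eq_add] at hshift
  have hg5 := norm_integral_le_mul_pi (hbd h5 (by norm_num) (by norm_num) hgb)
  have hg7 := norm_integral_le_mul_pi (hbd h7 (by norm_num) (by norm_num) hgb)
  rw [hshift]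
  refine (norm_add_le _ _).trans ((add_le_add_left (norm_sub_le _ _) _).trans ?_)
  rw [norm_mul, norm_mul]
  nlinarith [mul_le_mul_of_nonneg_left hg5 (norm_nonneg A),
    mul_le_mul_of_nonneg_left hg7 (norm_nonneg A)]

/-- The Gamma factor `Γ(s+k-1) Γ(s-1/2) / Γ(2-s)`. -/
noncomputable def gammaFactor (k : ℕ) (s : ℂ) : ℂ :=
  Complex.Gamma (s + k - 1) * (Complex.Gamma (s - 1/2) * (Complex.Gamma (2 - s))⁻¹)

lemma norm_gammaFactor_le {k : ℕ} (hk : 2 ≤ k) {s : ℂ} (h1 : 5/4 ≤ s.re) (h2 : s.re ≤ 7/4) :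
    ‖gammaFactor k s‖ ≤ 10 * Real.Gamma (k + 9) / (1 + s.im ^ 2) ^ 3 := by
  have hG : 0 < Real.Gamma (k + 9) := Real.Gamma_pos_of_pos (by positivity)
  rw [gammaFactor, norm_mul]
  calc _ ≤ Real.Gamma (k + 9) / (1 + s.im ^ 2) ^ 4 * (10 * (1 + s.im ^ 2)) := by
        gcongr
        · exact norm_Gamma_shift_le hk h1 h2
        · exact norm_Gamma_mul_inv_Gamma_le h1 h2
    _ = _ := by field_simp

lemma differentiableAt_Gamma_of_re_pos {s : ℂ} (hs : 0 < s.re) :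
    DifferentiableAt ℂ Complex.Gamma s := by
  refine Complex.differentiableAt_Gamma s ?_
  rintro m rfl
  simp at hs
  linarith [m.cast_nonneg (α := ℝ)]

lemma differentiableOn_gammaFactor {k : ℕ} (hk : 2 ≤ k) :
    DifferentiableOn ℂ (gammaFactor k) {s | 1 < s.re ∧ s.re < 2} := by
  have hk' : (2 : ℝ) ≤ k := mod_cast hk
  intro s hs
  obtain ⟨h1, h2⟩ : 1 < s.re ∧ s.re < 2 := hs
  refine DifferentiableAt.differentiableWithinAt (.mul ?_ (.mul ?_ ?_))
  · exact (differentiableAt_Gamma_of_re_pos (by simp; linarith)).comp s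
      ((differentiableAt_id.add_const _).sub_const _)
  · exact (differentiableAt_Gamma_of_re_pos (by simp; linarith)).comp s
      (differentiableAt_id.sub_const _)
  · exact (Complex.differentiable_one_div_Gamma (2 - s)).comp s (differentiableAt_id.const_sub _)

lemma integrable_gammaFactor_mul_cpow {k : ℕ} (hk : 2 ≤ k) {X : ℝ} (hX : 0 < X) :
    Integrable fun t : ℝ ↦ gammaFactor k ((5/4 : ℝ) + t * Complex.I) *
      (X : ℂ) ^ (-((5/4 : ℝ) + t * Complex.I)) := by
  have hX' : (X : ℂ) ≠ 0 := by exact_mod_cast hX.ne'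
  have hpos : 0 < Real.Gamma (k + 9) := Real.Gamma_pos_of_pos (by positivity)
  refine integrable_of_norm_le_inv (M := 10 * Real.Gamma (k + 9) * X ^ (-(5/4 : ℝ)))
    ((continuous_comp_vertical (differentiableOn_gammaFactor hk) (by norm_num)
      (by norm_num)).mul (Continuous.const_cpow (by fun_prop) (Or.inl hX'))) fun t ↦ ?_
  have hb := norm_gammaFactor_le hk (s := (5/4 : ℝ) + t * Complex.I) (by simp) (by norm_num)
  simp only [Complex.add_im, Complex.ofReal_im, Complex.mul_im, Complex.ofReal_re, Complex.I_im,
    mul_one, Complex.I_re, mul_zero, add_zero, zero_add] at hb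
  rw [norm_mul, Complex.norm_cpow_eq_rpow_re_of_pos hX, mul_div_right_comm]
  simp only [Complex.neg_re, Complex.add_re, Complex.ofReal_re, Complex.mul_re, Complex.I_re,
    mul_zero, Complex.ofReal_im, Complex.I_im, mul_one, sub_self, add_zero]
  gcongr
  refine hb.trans ?_
  gcongr
  exact le_self_pow₀ (by nlinarith [sq_nonneg t]) (by norm_num)

lemma integrable_Dser_mul_gammaFactor {k : ℕ} (hk : 2 ≤ k) {lam : ℕ → ℝ}
    (hlam : ∀ n : ℕ, 0 < n → |lam n| ≤ (n.divisors.card : ℝ)) {X : ℝ} (hX : 0 < X) :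
    Integrable fun t : ℝ ↦ Dser lam ((5/4 : ℝ) + t * Complex.I) *
      gammaFactor k ((5/4 : ℝ) + t * Complex.I) * (X : ℂ) ^ (-((5/4 : ℝ) + t * Complex.I)) := by
  have hD : Continuous fun t : ℝ ↦ Dser lam ((5/4 : ℝ) + t * Complex.I) :=
    continuous_comp_vertical (b := 2) ((differentiableOn_Dser hlam (c := 9/8) (by norm_num)).mono
      fun s hs ↦ hs.1) (by norm_num) (by norm_num)
  simp_rw [mul_assoc]
  exact (integrable_gammaFactor_mul_cpow hk hX).bdd_mul hD.aestronglyMeasurable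
    (.of_forall fun t ↦ norm_Dser_le hlam (c := 5/4) (by norm_num) (by simp))

lemma tsum_mul_Wk_eq {k : ℕ} (hk : 2 ≤ k) {lam : ℕ → ℝ}
    (hlam : ∀ n : ℕ, 0 < n → |lam n| ≤ (n.divisors.card : ℝ)) {X : ℝ} (hX : 0 < X) :
    ∑' n : ℕ+, (((lam n) ^ 2 : ℝ) : ℂ) * Wk k ((n : ℕ) * X) = (1 / (2 * π)) *
      ∫ t : ℝ, Dser lam ((5/4 : ℝ) + t * Complex.I) * gammaFactor k ((5/4 : ℝ) + t * Complex.I) *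
        (X : ℂ) ^ (-((5/4 : ℝ) + t * Complex.I)) := by
  set G : ℝ → ℂ := fun t ↦ gammaFactor k ((5/4 : ℝ) + t * Complex.I) *
    (X : ℂ) ^ (-((5/4 : ℝ) + t * Complex.I)) with hG
  set a : ℕ+ → ℝ → ℂ := fun n t ↦
    (((lam n)^2 : ℝ) : ℂ) / ((n : ℕ) : ℂ) ^ ((5/4 : ℝ) + t * Complex.I) with ha
  have hGi : Integrable G := integrable_gammaFactor_mul_cpow hk hX
  have hnorm (n : ℕ+) (t : ℝ) : ‖a n t‖ = lam n ^ 2 / ((n : ℕ) : ℝ) ^ (5/4 : ℝ) := by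
    simp only [ha]
    rw [norm_Dser_term]
    simp
  have hsum54 := summable_sq_mul_rpow hlam (c := 5/4) (by norm_num)
  have hac (n : ℕ+) : Continuous (a n) := by
    have hn : ((n : ℕ) : ℂ) ≠ 0 := by simp
    refine continuous_const.div (Continuous.const_cpow (by fun_prop) (Or.inl hn)) fun t ↦ ?_
    simp [Complex.cpow_eq_zero_iff]
  have hFi (n : ℕ+) : Integrable fun t ↦ a n t * G t :=
    hGi.bdd_mul (c := lam n ^ 2 / ((n : ℕ) : ℝ) ^ (5/4 : ℝ)) (hac n).aestronglyMeasurable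
      (.of_forall fun t ↦ (hnorm n t).le)
  have hS := hasSum_integral_of_summable_integral_norm hFi (by
    simp_rw [norm_mul, hnorm, integral_const_mul]
    exact hsum54.mul_right _)
  have hWk (n : ℕ+) : (((lam n) ^ 2 : ℝ) : ℂ) * Wk k ((n : ℕ) * X) =
      (1 / (2 * π)) * ∫ t : ℝ, a n t * G t := by
    rw [Wk, mul_left_comm, ← integral_const_mul]
    congr 2
    ext t
    simp only [ha, hG, gammaFactor]
    rw [Complex.ofReal_mul, Complex.mul_cpow_ofReal_nonneg (by positivity) hX.le]
    push_cast
    rw [show (5/4 + t * Complex.I + k - 1 : ℂ) = k + 1/4 + t * Complex.I by ring,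
      show (5/4 + t * Complex.I - 1/2 : ℂ) = 3/4 + t * Complex.I by ring,
      show (2 - (5/4 + t * Complex.I) : ℂ) = 3/4 - t * Complex.I by ring]
    rw [Complex.cpow_neg ((n : ℕ) : ℂ)]
    ring
  simp_rw [hWk]
  rw [tsum_mul_left, hS.tsum_eq]
  congr 2
  ext t
  rw [tsum_mul_right, mul_assoc]
  rfl

/-- The integrand of `C_{f,1} - c_f / (2√π)`, up to normalization, with its simple pole at
`s = 3/2` removed. -/
noncomputable def diffKernel (k : ℕ) (lam : ℕ → ℝ) (z X : ℝ) (s : ℂ) : ℂ :=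
  Dser lam s * gammaFactor k s * ((1 - s) / 2 * z * confluentTail (2 - s) z) * (X : ℂ) ^ (-s)

lemma differentiableOn_diffKernel {k : ℕ} (hk : 2 ≤ k) {lam : ℕ → ℝ}
    (hlam : ∀ n : ℕ, 0 < n → |lam n| ≤ (n.divisors.card : ℝ)) {z X : ℝ} (hz : 0 ≤ z) (hX : 0 < X) :
    DifferentiableOn ℂ (diffKernel k lam z X) {s | 1 < s.re ∧ s.re < 2} := by
  intro s hs
  have hnhds := (isOpen_strip 1 2).mem_nhds hs
  obtain ⟨h1, h2⟩ : 1 < s.re ∧ s.re < 2 := hs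
  have hX' : (X : ℂ) ≠ 0 := by exact_mod_cast hX.ne'
  have hD : DifferentiableAt ℂ (Dser lam) s := by
    obtain ⟨c, hc1, hc2⟩ := exists_between h1
    exact (differentiableOn_Dser hlam hc1).differentiableAt
      ((isOpen_lt continuous_const Complex.continuous_re).mem_nhds hc2)
  have hQ : DifferentiableAt ℂ (fun p ↦ confluentTail p z) (2 - s) :=
    (differentiableOn_confluentTail hz).differentiableAt
      ((isOpen_lt continuous_const Complex.continuous_re).mem_nhds (by
        change 0 < (2 - s).re
        simp; linarith))
  refine DifferentiableAt.differentiableWithinAt (.mul (.mul (.mul hD ?_) (.mul (by fun_prop) ?_)) ?_)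
  · exact (differentiableOn_gammaFactor hk).differentiableAt hnhds
  · exact hQ.comp s (differentiableAt_id.const_sub _)
  · exact differentiableAt_id.neg.const_cpow (Or.inl hX')

lemma norm_diffKernel_le {k : ℕ} (hk : 2 ≤ k) {lam : ℕ → ℝ}
    (hlam : ∀ n : ℕ, 0 < n → |lam n| ≤ (n.divisors.card : ℝ)) :
    ∃ M > 0, ∀ {z X : ℝ}, 0 ≤ z → 0 < X → ∀ {s : ℂ}, 5/4 ≤ s.re → s.re ≤ 7/4 →
      ‖diffKernel k lam z X s‖ ≤
        M * (z * ‖confluentTail (2 - s) z‖ * X ^ (-s.re)) / (1 + s.im ^ 2) ^ 2 := by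
  have hG : 0 < Real.Gamma (k + 9) := Real.Gamma_pos_of_pos (by positivity)
  set S := ∑' n : ℕ+, lam n ^ 2 / ((n : ℕ) : ℝ) ^ (5/4 : ℝ)
  have hS : 0 ≤ S := tsum_nonneg fun n ↦ by positivity
  refine ⟨(S + 1) * (10 * Real.Gamma (k + 9)), by positivity, fun {z X} hz hX {s} h1 h2 ↦ ?_⟩
  have h1s : ‖(1 - s) / 2‖ ≤ 1 + s.im ^ 2 := by
    refine abs_le_of_sq_le_sq' ?_ (by positivity) |>.2
    rw [norm_div, div_pow, norm_sq_eq_re_sq_add_im_sq, Complex.norm_ofNat]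
    simp only [Complex.sub_re, Complex.one_re, Complex.sub_im, Complex.one_im]
    nlinarith [sq_nonneg s.im, sq_nonneg (s.im ^ 2)]
  have hD : ‖Dser lam s‖ ≤ S + 1 := (norm_Dser_le hlam (by norm_num) h1).trans (by linarith)
  rw [diffKernel, norm_mul, norm_mul, norm_mul, norm_mul, norm_mul, Complex.norm_real,
    Real.norm_of_nonneg hz, Complex.norm_cpow_eq_rpow_re_of_pos hX, Complex.neg_re]
  calc _ ≤ (S + 1) * (10 * Real.Gamma (k + 9) / (1 + s.im ^ 2) ^ 3) *
        ((1 + s.im ^ 2) * z * ‖confluentTail (2 - s) z‖) * X ^ (-s.re) := by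
        gcongr
        exact norm_gammaFactor_le hk h1 h2
    _ = _ := by field_simp

/-- Bounds for the difference integral: directly on `Re s = 5/4`, and after moving the line of
integration to `Re s = 7/4`. -/
lemma norm_integral_diffKernel_le {k : ℕ} (hk : 2 ≤ k) {lam : ℕ → ℝ}
    (hlam : ∀ n : ℕ, 0 < n → |lam n| ≤ (n.divisors.card : ℝ)) :
    ∃ C > 0, ∀ {z X : ℝ}, 0 < z → 0 < X →
      (Integrable fun t : ℝ ↦ diffKernel k lam z X ((5/4 : ℝ) + t * Complex.I) /
        ((5/4 : ℝ) + t * Complex.I - 3/2)) ∧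
      ‖∫ t : ℝ, diffKernel k lam z X ((5/4 : ℝ) + t * Complex.I) /
        ((5/4 : ℝ) + t * Complex.I - 3/2)‖ ≤ C * (z * Real.exp z * X ^ (-(5/4) : ℝ)) ∧
      ‖∫ t : ℝ, diffKernel k lam z X ((5/4 : ℝ) + t * Complex.I) /
        ((5/4 : ℝ) + t * Complex.I - 3/2)‖ ≤
          C * (z * (X ^ (-(7/4) : ℝ) + X ^ (-(3/2) : ℝ))) := by
  obtain ⟨M, hM0, hM⟩ := norm_diffKernel_le hk hlam
  set A : ℝ → ℝ := fun x ↦ ProbabilityTheory.beta x x *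
    (Real.Gamma (x + 1/2) / Real.Gamma (x + 1)) with hA
  have hApos {x : ℝ} (hx : 0 < x) : 0 < A x :=
    mul_pos (ProbabilityTheory.beta_pos hx hx)
      (div_pos (Real.Gamma_pos_of_pos (by linarith)) (Real.Gamma_pos_of_pos (by linarith)))
  have hA4 := hApos (x := 1/4) (by norm_num)
  have hA2 := hApos (x := 1/2) (by norm_num)
  have hπ := Real.pi_pos
  have him (σ t : ℝ) : (σ + t * Complex.I : ℂ).im = t := by simp
  have hre (σ t : ℝ) : (σ + t * Complex.I : ℂ).re = σ := by simp
  have h5 : |(5/4 : ℝ) - 3/2| = 1/4 := by norm_num [abs_of_neg]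
  have h7 : |(7/4 : ℝ) - 3/2| = 1/4 := by norm_num
  refine ⟨4 * M * π + 4 * M * A (1/4) * π + 32 * π * M * A (1/2), by positivity,
    fun {z X} hz hX ↦ ?_⟩
  have hd := differentiableOn_diffKernel hk hlam hz.le hX
  have hstrip {s : ℂ} (h1 : 5/4 ≤ s.re) (h2 : s.re ≤ 7/4) : ‖diffKernel k lam z X s‖ ≤
      M * (z * Real.exp z * X ^ (-s.re)) / (1 + s.im ^ 2) := by
    refine (hM hz.le hX h1 h2).trans ?_
    gcongr
    · exact norm_confluentTail_le_exp (by simp; linarith) hz.le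
    · exact le_self_pow₀ (by nlinarith [sq_nonneg s.im]) two_ne_zero
  have hline5 (t : ℝ) : ‖diffKernel k lam z X ((5/4 : ℝ) + t * Complex.I) /
      ((5/4 : ℝ) + t * Complex.I - 3/2)‖ ≤
        4 * (M * (z * Real.exp z * X ^ (-(5/4) : ℝ))) / (1 + t ^ 2) := by
    have := hstrip (s := (5/4 : ℝ) + t * Complex.I) (by rw [hre]) (by rw [hre]; norm_num)
    rw [hre, him] at this
    exact norm_div_vertical_sub_le h5 this
  have hQ7 (t : ℝ) :
      ‖confluentTail (2 - ((7/4 : ℝ) + t * Complex.I)) z‖ ≤ A (1/4) * (1 + t ^ 2) := by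
    have hr : (2 - ((7/4 : ℝ) + t * Complex.I) : ℂ).re = 1/4 := by
      rw [Complex.sub_re, hre]; norm_num
    have h := norm_confluentTail_le (p := 2 - ((7/4 : ℝ) + t * Complex.I)) (by rw [hr]; norm_num)
      (by rw [hr]; norm_num) hz
    rw [hr] at h
    refine h.trans (mul_le_mul_of_nonneg_left ?_ hA4.le)
    refine abs_le_of_sq_le_sq' ?_ (by positivity) |>.2
    rw [norm_sq_eq_re_sq_add_im_sq, hr, Complex.sub_im, him]
    simp only [Complex.im_ofNat]
    nlinarith [sq_nonneg t, sq_nonneg (t ^ 2)]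
  have hline7 (t : ℝ) : ‖diffKernel k lam z X ((7/4 : ℝ) + t * Complex.I) /
      ((7/4 : ℝ) + t * Complex.I - 3/2)‖ ≤
        4 * (M * (z * A (1/4) * X ^ (-(7/4) : ℝ))) / (1 + t ^ 2) := by
    have h := hM hz.le hX (s := (7/4 : ℝ) + t * Complex.I) (by rw [hre]; norm_num) (by rw [hre])
    rw [hre, him] at h
    refine norm_div_vertical_sub_le h7 (h.trans ?_)
    calc _ ≤ M * (z * (A (1/4) * (1 + t ^ 2)) * X ^ (-(7/4) : ℝ)) / (1 + t ^ 2) ^ 2 := by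
          gcongr
          exact hQ7 t
      _ = _ := by field_simp
  have hpole : ‖diffKernel k lam z X (3/2)‖ ≤ M * (z * A (1/2) * X ^ (-(3/2) : ℝ)) := by
    have hr : (3/2 : ℂ).re = 3/2 := by norm_num
    have hi : (3/2 : ℂ).im = 0 := by norm_num
    have h := hM hz.le hX (s := 3/2) (by rw [hr]; norm_num) (by rw [hr]; norm_num)
    rw [hr, hi, show (2 - 3/2 : ℂ) = 1/2 by norm_num] at h
    have hr2 : (1/2 : ℂ).re = 1/2 := by norm_num
    have hQ := norm_confluentTail_le (p := 1/2) (by rw [hr2]; norm_num) (by rw [hr2]) hz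
    rw [hr2] at hQ
    have hQ' : ‖confluentTail (1/2) z‖ ≤ A (1/2) :=
      hQ.trans (mul_le_of_le_one_right hA2.le (by norm_num))
    refine h.trans ?_
    norm_num only [div_one]
    gcongr
  refine ⟨?_, ?_, ?_⟩
  · refine integrable_of_norm_le_inv (Continuous.div ?_ (by fun_prop) fun t h ↦ ?_) hline5
    · exact continuous_comp_vertical hd (by norm_num) (by norm_num)
    · have := norm_vertical_sub_ge h5 t
      rw [h, norm_zero] at this
      norm_num at this
  · refine (norm_integral_le_mul_pi hline5).trans ?_
    have hE : 0 ≤ z * Real.exp z * X ^ (-(5/4) : ℝ) := by positivity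
    have h1 : 0 ≤ 4 * M * A (1/4) * π + 32 * π * M * A (1/2) := by positivity
    nlinarith [mul_nonneg h1 hE]
  · refine (norm_integral_le_of_simple_pole (M := M * (z * Real.exp z * max (X ^ (-(5/4) : ℝ))
      (X ^ (-(7/4) : ℝ)))) hd fun s h1 h2 ↦ (hstrip h1 h2).trans ?_).trans ?_
    · gcongr
      rcases le_total 1 X with h | h
      · exact (Real.rpow_le_rpow_of_exponent_le h (by linarith)).trans (le_max_left _ _)
      · exact (Real.rpow_le_rpow_of_exponent_ge hX h (by linarith)).trans (le_max_right _ _)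
    · have ha : 0 ≤ z * X ^ (-(7/4) : ℝ) := by positivity
      have hb : 0 ≤ z * X ^ (-(3/2) : ℝ) := by positivity
      calc _ ≤ 4 * (M * (z * A (1/4) * X ^ (-(7/4) : ℝ))) * π +
            32 * π * (M * (z * A (1/2) * X ^ (-(3/2) : ℝ))) := by
            gcongr
            exact norm_integral_le_mul_pi hline7
        _ = 4 * M * A (1/4) * π * (z * X ^ (-(7/4) : ℝ)) +
            32 * π * M * A (1/2) * (z * X ^ (-(3/2) : ℝ)) := by ring
        _ ≤ (4 * M * π + 4 * M * A (1/4) * π + 32 * π * M * A (1/2)) * (z * X ^ (-(7/4) : ℝ)) +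
            (4 * M * π + 4 * M * A (1/4) * π + 32 * π * M * A (1/2)) * (z * X ^ (-(3/2) : ℝ)) := by
            have e1 : 0 ≤ 4 * M * π := by positivity
            have e2 : 0 ≤ 4 * M * A (1/4) * π := by positivity
            have e3 : 0 ≤ 32 * π * M * A (1/2) := by positivity
            gcongr <;> linarith
        _ = _ := by ring

/-- The difference of the two integrands defining `C_{f,1}` and `c_f` is a kernel with a simple
pole at `3/2`. -/
lemma Cf1_sub_cf_eq {k : ℕ} (hk : 2 ≤ k) {lam : ℕ → ℝ}
    (hlam : ∀ n : ℕ, 0 < n → |lam n| ≤ (n.divisors.card : ℝ)) {y Y : ℝ} (hy : 0 < y)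
    (hY : 0 < Y) :
    Cf1 k lam y Y - ((1 / (2 * Real.sqrt π) : ℝ) : ℂ) * cf k lam (4 * π * y * Y ^ 2) =
      ((π ^ 2 * y * Y ^ 2 : ℝ) : ℂ) * (1 / (2 * π)) *
        ∫ t : ℝ, diffKernel k lam (4 * π * y * Y) (4 * π ^ 3 * y * Y ^ 2)
          ((5/4 : ℝ) + t * Complex.I) / ((5/4 : ℝ) + t * Complex.I - 3/2) := by
  have hX : 0 < 4 * π ^ 3 * y * Y ^ 2 := by positivity
  have hz : 0 < 4 * π * y * Y := by positivity
  obtain ⟨C, -, hC⟩ := norm_integral_diffKernel_le hk hlam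
  have hdiff := (hC hz hX).1
  have hcf : ((1 / (2 * Real.sqrt π) : ℝ) : ℂ) * cf k lam (4 * π * y * Y ^ 2) =
      ((π ^ 2 * y * Y ^ 2 : ℝ) : ℂ) * ∑' n : ℕ+, (((lam n) ^ 2 : ℝ) : ℂ) *
        Wk k ((n : ℕ) * (4 * π ^ 3 * y * Y ^ 2)) := by
    rw [cf, ← mul_assoc, ← Complex.ofReal_mul]
    congr 2
    · have h : π ^ ((3 : ℝ) / 2) = π * √π := by
        rw [show (3 : ℝ) / 2 = 1 + 1 / 2 by norm_num, Real.rpow_add Real.pi_pos, Real.rpow_one,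
          Real.sqrt_eq_rpow]
      rw [h]
      field_simp
      ring
    · ext n
      rw [show π ^ 2 * (n : ℕ) * (4 * π * y * Y ^ 2) = (n : ℕ) * (4 * π ^ 3 * y * Y ^ 2) by ring]
  rw [hcf, tsum_mul_Wk_eq hk hlam hX, Cf1, ← mul_assoc, ← mul_sub]
  congr 1
  have hI := integrable_Dser_mul_gammaFactor hk hlam hX
  rw [sub_eq_iff_eq_add', ← integral_add hI hdiff]
  congr 1
  ext t
  have hF := oneF1_eq (p := 2 - ((5/4 : ℝ) + t * Complex.I)) (by norm_num) hz.le
  rw [show (2 - ((5/4 : ℝ) + t * Complex.I) - 1 : ℂ) = -(1/4) - t * Complex.I by push_cast; ring,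
    show (2 * (2 - ((5/4 : ℝ) + t * Complex.I)) - 1 : ℂ) = 1/2 - 2 * t * Complex.I by
      push_cast; ring] at hF
  rw [hF]
  simp only [diffKernel, gammaFactor]
  rw [show ((5/4 : ℝ) + t * Complex.I + k - 1 : ℂ) = k + 1/4 + t * Complex.I by push_cast; ring,
    show ((5/4 : ℝ) + t * Complex.I - 1/2 : ℂ) = 3/4 + t * Complex.I by push_cast; ring,
    show (2 - ((5/4 : ℝ) + t * Complex.I) : ℂ) = 3/4 - t * Complex.I by push_cast; ring,
    show ((5/4 : ℝ) + t * Complex.I - 3/2 : ℂ) = -(1/2 - 2 * t * Complex.I) / 2 by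
      push_cast; ring,
    show (1 - ((5/4 : ℝ) + t * Complex.I) : ℂ) = -(1/4) - t * Complex.I by push_cast; ring]
  have hne : (1/2 - 2 * t * Complex.I : ℂ) ≠ 0 := fun h ↦ by
    simpa using congrArg Complex.re h
  push_cast
  field_simp
  ring

/-- The two regimes `y * Y ^ 2 ≤ 1` and `1 ≤ y * Y ^ 2` in the size of the error term. -/
lemma min_error_le {y Y I C : ℝ} (hy : 0 < y) (hY : 1 ≤ Y) (hC : 0 < C)
    (h₁ : I ≤ C * (4 * π * y * Y * exp (4 * π * y * Y) * (4 * π ^ 3 * y * Y ^ 2) ^ (-(5/4) : ℝ)))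
    (h₂ : I ≤ C * (4 * π * y * Y *
      ((4 * π ^ 3 * y * Y ^ 2) ^ (-(7/4) : ℝ) + (4 * π ^ 3 * y * Y ^ 2) ^ (-(3/2) : ℝ)))) :
    y * Y ^ 2 * I ≤ 4 * π * C * (exp (4 * π) + 2) * y ^ ((1 : ℝ) / 2) := by
  have hY0 : 0 < Y := by linarith
  set Z := y * Y ^ 2 with hZ
  have hZ0 : 0 < Z := by positivity
  have hX : Z ≤ 4 * π ^ 3 * y * Y ^ 2 := by
    have h3 : 1 ≤ π ^ 3 := one_le_pow₀ (by linarith [Real.pi_gt_three])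
    nlinarith
  have hyY : y * Y = y ^ ((1 : ℝ) / 2) * Z ^ ((1 : ℝ) / 2) := by
    rw [← Real.mul_rpow hy.le hZ0.le, ← Real.sqrt_eq_rpow, hZ,
      show y * (y * Y ^ 2) = (y * Y) ^ 2 by ring, Real.sqrt_sq (by positivity)]
  have hpow (a b : ℝ) (hb : b = a - 3/2) : Z * Z ^ ((1 : ℝ) / 2) * Z ^ b = Z ^ a := by
    nth_rewrite 1 [← Real.rpow_one Z]
    rw [← Real.rpow_add hZ0, ← Real.rpow_add hZ0]
    congr 1
    linarith
  have hle (b : ℝ) (hb : b ≤ 0) : (4 * π ^ 3 * y * Y ^ 2) ^ b ≤ Z ^ b :=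
    Real.rpow_le_rpow_of_nonpos hZ0 hX hb
  have hpi := Real.pi_pos
  rcases le_total Z 1 with h | h
  · have hexp : exp (4 * π * y * Y) ≤ exp (4 * π) := by
      apply Real.exp_le_exp.2
      have : y * Y ≤ 1 := by nlinarith [mul_pos hy hY0]
      nlinarith
    calc Z * I ≤ Z * (C * (4 * π * y * Y * exp (4 * π) * Z ^ (-(5/4) : ℝ))) := by
          gcongr
          have h54 := hle (-(5/4)) (by norm_num)
          exact h₁.trans (by gcongr)
      _ = 4 * π * C * exp (4 * π) * y ^ ((1 : ℝ) / 2) *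
            (Z * Z ^ ((1 : ℝ) / 2) * Z ^ (-(5/4) : ℝ)) := by
          rw [mul_assoc (4 * π) y Y, hyY]
          ring
      _ = 4 * π * C * exp (4 * π) * y ^ ((1 : ℝ) / 2) * Z ^ (1/4 : ℝ) := by
          rw [hpow (1/4) _ (by norm_num)]
      _ ≤ 4 * π * C * (exp (4 * π) + 2) * y ^ ((1 : ℝ) / 2) * 1 := by
          gcongr
          · linarith
          · exact Real.rpow_le_one hZ0.le h (by norm_num)
      _ = _ := mul_one _
  · calc Z * I ≤ Z * (C * (4 * π * y * Y * (Z ^ (-(7/4) : ℝ) + Z ^ (-(3/2) : ℝ)))) := by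
          gcongr
          have h74 := hle (-(7/4)) (by norm_num)
          have h32 := hle (-(3/2)) (by norm_num)
          exact h₂.trans (by gcongr)
      _ = 4 * π * C * y ^ ((1 : ℝ) / 2) * (Z * Z ^ ((1 : ℝ) / 2) * Z ^ (-(7/4) : ℝ) +
            Z * Z ^ ((1 : ℝ) / 2) * Z ^ (-(3/2) : ℝ)) := by
          rw [mul_assoc (4 * π) y Y, hyY]
          ring
      _ = 4 * π * C * y ^ ((1 : ℝ) / 2) * (Z ^ (-(1/4) : ℝ) + Z ^ (0 : ℝ)) := by
          rw [hpow (-(1/4)) _ (by norm_num), hpow 0 _ (by norm_num)]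
      _ ≤ 4 * π * C * y ^ ((1 : ℝ) / 2) * (exp (4 * π) + 2) := by
          have h1 : Z ^ (-(1/4) : ℝ) ≤ 1 := Real.rpow_le_one_of_one_le_of_nonpos h (by norm_num)
          have h2 := Real.exp_pos (4 * π)
          rw [Real.rpow_zero]
          gcongr 4 * π * C * y ^ ((1 : ℝ) / 2) * ?_
          linarith
      _ = _ := by ring

/-- Lemma 1.  For `0 < y ≤ 1` and `Y ≥ 1`,
`C_{f,1}(y,Y) = (1/(2√π)) c_f(4πyY²) + O_f(y^(1/2))`. -/
theorem lemma_one (k : ℕ) (hk : Even k) (hk0 : 0 < k)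
    (lam : ℕ → ℝ) (hlam1 : lam 1 = 1)
    (hHecke : ∀ m n : ℕ, 0 < m → 0 < n →
      lam m * lam n = ∑ d ∈ (Nat.gcd m n).divisors, lam (m * n / d ^ 2))
    (hDeligne : ∀ n : ℕ, 0 < n → |lam n| ≤ (n.divisors.card : ℝ)) :
    ∃ C > (0:ℝ), ∀ y Y : ℝ, 0 < y → y ≤ 1 → 1 ≤ Y →
      ‖Cf1 k lam y Y - ((1 / (2 * Real.sqrt Real.pi) : ℝ) : ℂ) *
          cf k lam (4 * Real.pi * y * Y^2)‖ ≤ C * y ^ ((1:ℝ)/2) := by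
  obtain ⟨m, hm⟩ := hk
  have hk2 : 2 ≤ k := by omega
  obtain ⟨C, hC, hbound⟩ := norm_integral_diffKernel_le hk2 hDeligne
  refine ⟨2 * π ^ 2 * C * (exp (4 * π) + 2), by positivity, fun y Y hy _ hY ↦ ?_⟩
  have hY0 : 0 < Y := by linarith
  obtain ⟨-, h₁, h₂⟩ := hbound (z := 4 * π * y * Y) (X := 4 * π ^ 3 * y * Y ^ 2)
    (by positivity) (by positivity)
  rw [Cf1_sub_cf_eq hk2 hDeligne hy hY0]
  have hpre : ‖((π ^ 2 * y * Y ^ 2 : ℝ) : ℂ) * (1 / (2 * π))‖ = π / 2 * (y * Y ^ 2) := by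
    rw [show ((π ^ 2 * y * Y ^ 2 : ℝ) : ℂ) * (1 / (2 * π)) = ((π / 2 * (y * Y ^ 2) : ℝ) : ℂ) by
      push_cast
      field_simp]
    rw [Complex.norm_real, Real.norm_of_nonneg (by positivity)]
  rw [norm_mul, hpre, mul_assoc]
  refine (mul_le_mul_of_nonneg_left (min_error_le hy hY hC h₁ h₂) (by positivity)).trans_eq ?_
  ring
end

section
/- The function c_f decays faster than any polynomial at infinity: for every positive integer N there exists a constant C > 0 (depending on f and N) such that |c_f(α)| ≤ C α^(−N) for all α ≥ 1. -/
open MeasureTheory Real Filter Finset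

/-- The Gamma function is bounded in absolute value by its value at the real part. -/
theorem norm_Gamma_le_Gamma_re_s5 {z : ℂ} (hz : 0 < z.re) :
    ‖Complex.Gamma z‖ ≤ Real.Gamma z.re := by
  rw [Complex.Gamma_eq_integral hz, Complex.GammaIntegral, Real.Gamma_eq_integral hz]
  refine (norm_integral_le_integral_norm _).trans_eq
    (setIntegral_congr_fun measurableSet_Ioi fun t ht ↦ ?_)
  have ht : 0 < t := ht
  simp [Complex.norm_cpow_eq_rpow_re_of_pos ht, Complex.norm_exp]

/-- Shifting the real part to the right decreases the Gamma function on vertical lines at most as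
fast as it does on the real axis. -/
theorem norm_Gamma_mul_Gamma_add_le {u : ℂ} {v : ℝ} (hu : 0 < u.re) (hv : 0 < v) :
    ‖Complex.Gamma u‖ * Real.Gamma (u.re + v) ≤ ‖Complex.Gamma (u + v)‖ * Real.Gamma u.re := by
  have hB : ‖Complex.betaIntegral u v‖ ≤ ‖Complex.betaIntegral u.re v‖ := by
    have key : Complex.betaIntegral u.re v =
        ((∫ t in (0 : ℝ)..1, t ^ (u.re - 1) * (1 - t) ^ (v - 1) : ℝ) : ℂ) := by
      rw [Complex.betaIntegral, ← intervalIntegral.integral_ofReal]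
      refine intervalIntegral.integral_congr fun t ht ↦ ?_
      rw [Set.uIcc_of_le zero_le_one] at ht
      rw [Complex.ofReal_mul, Complex.ofReal_cpow ht.1, Complex.ofReal_cpow (by linarith [ht.2])]
      push_cast
      rfl
    rw [key, Complex.norm_real, Complex.betaIntegral]
    refine le_trans ?_ (le_abs_self _)
    refine (intervalIntegral.norm_integral_le_integral_norm zero_le_one).trans_eq ?_
    refine intervalIntegral.integral_congr_ae ?_
    have h1 : ∀ᵐ t : ℝ, t ≠ 1 := by simp [ae_iff, measure_singleton]
    filter_upwards [h1] with t ht1 ht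
    rw [Set.uIoc_of_le zero_le_one] at ht
    have ht' : 0 < 1 - t := sub_pos.2 (lt_of_le_of_ne ht.2 ht1)
    rw [norm_mul, Complex.norm_cpow_eq_rpow_re_of_pos ht.1, ← Complex.ofReal_one,
      ← Complex.ofReal_sub, Complex.norm_cpow_eq_rpow_re_of_pos ht']
    simp
  have e1 := Complex.Gamma_mul_Gamma_eq_betaIntegral (s := u) (t := v) hu (by simpa using hv)
  have e2 := Complex.Gamma_mul_Gamma_eq_betaIntegral (s := u.re) (t := v) (by simpa using hu)
    (by simpa using hv)
  have n1 := congrArg norm e1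
  have n2 := congrArg norm e2
  rw [← Complex.ofReal_add] at n2
  simp only [norm_mul, Complex.Gamma_ofReal, Complex.norm_real, Real.norm_eq_abs] at n1 n2
  have g1 := Real.Gamma_pos_of_pos hu
  have g2 := Real.Gamma_pos_of_pos hv
  have g3 := Real.Gamma_pos_of_pos (add_pos hu hv)
  rw [abs_of_pos g2] at n1
  rw [abs_of_pos g1, abs_of_pos g2, abs_of_pos g3] at n2
  refine le_of_mul_le_mul_right ?_ g2
  calc ‖Complex.Gamma u‖ * Real.Gamma (u.re + v) * Real.Gamma v
      = ‖Complex.Gamma (u + v)‖ * ‖Complex.betaIntegral u v‖ * Real.Gamma (u.re + v) := by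
        rw [← n1]; ring
    _ ≤ ‖Complex.Gamma (u + v)‖ * ‖Complex.betaIntegral u.re v‖ * Real.Gamma (u.re + v) := by
        gcongr
    _ = ‖Complex.Gamma (u + v)‖ * Real.Gamma u.re * Real.Gamma v := by
        rw [mul_assoc _ (Real.Gamma u.re), n2]; ring

theorem norm_Gamma_mul_norm_pow_le_norm_Gamma_add {w : ℂ} (hw : 0 < w.re) (n : ℕ) :
    ‖Complex.Gamma w‖ * ‖w‖ ^ n ≤ ‖Complex.Gamma (w + n)‖ := by
  induction n with
  | zero => simp
  | succ n ih =>
    have hre : 0 < (w + n).re := by simp; positivity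
    have hne : w + n ≠ 0 := fun h ↦ by simp [h] at hre
    have hle : ‖w‖ ≤ ‖w + n‖ := by
      rw [← sq_le_sq₀ (norm_nonneg _) (norm_nonneg _), Complex.sq_norm, Complex.sq_norm,
        Complex.normSq_apply, Complex.normSq_apply]
      simp only [Complex.add_re, Complex.natCast_re, Complex.add_im, Complex.natCast_im, add_zero]
      have : (0 : ℝ) ≤ n := n.cast_nonneg
      nlinarith
    rw [Nat.cast_succ, ← add_assoc, Complex.Gamma_add_one _ hne, norm_mul, pow_succ, ← mul_assoc,
      mul_comm]
    gcongr

/-- The Gamma function decays faster than any power on vertical lines in the right half plane. -/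
theorem norm_Gamma_mul_norm_pow_le {w : ℂ} (hw : 0 < w.re) (n : ℕ) :
    ‖Complex.Gamma w‖ * ‖w‖ ^ n ≤ Real.Gamma (w.re + n) := by
  refine (norm_Gamma_mul_norm_pow_le_norm_Gamma_add hw n).trans ?_
  have hre : 0 < (w + n).re := by simp; positivity
  simpa using norm_Gamma_le_Gamma_re_s5 hre

theorem inv_Gamma_eq_prod_mul (z : ℂ) (m : ℕ) :
    (Complex.Gamma z)⁻¹ = (∏ j ∈ Finset.range m, (z + j)) * (Complex.Gamma (z + m))⁻¹ := by
  induction m with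
  | zero => simp
  | succ m ih =>
    rw [ih, Complex.one_div_Gamma_eq_self_mul_one_div_Gamma_add_one (z + m),
      Finset.prod_range_succ, Nat.cast_succ, ← add_assoc, mul_assoc]

/-- Shift of a vertical line of integration. -/
theorem integral_vertical_eq_of_norm_le {H : ℂ → ℂ} {a b C : ℝ} (hab : a ≤ b)
    (hH : DifferentiableOn ℂ H (Complex.re ⁻¹' Set.Icc a b))
    (hbound : ∀ s : ℂ, s.re ∈ Set.Icc a b → ‖H s‖ ≤ C * (1 + s.im ^ 2)⁻¹) :
    ∫ t : ℝ, H (a + t * Complex.I) = ∫ t : ℝ, H (b + t * Complex.I) := by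
  have hint (c : ℝ) (hc : c ∈ Set.Icc a b) : Integrable fun t : ℝ ↦ H (c + t * Complex.I) := by
    refine (integrable_inv_one_add_sq.const_mul C).mono' ?_ (.of_forall fun t ↦ ?_)
    · refine Continuous.aestronglyMeasurable ?_
      refine hH.continuousOn.comp_continuous (by fun_prop) fun t ↦ ?_
      simpa using hc
    · simpa using hbound (c + t * Complex.I) (by simpa using hc)
  have hlim (c : ℝ) (hc : c ∈ Set.Icc a b) :
      Tendsto (fun T : ℝ ↦ ∫ t in (-T)..T, H (c + t * Complex.I)) atTop
        (nhds (∫ t : ℝ, H (c + t * Complex.I))) :=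
    intervalIntegral_tendsto_integral (hint c hc) tendsto_neg_atTop_atBot tendsto_id
  have hdecay : Tendsto (fun T : ℝ ↦ C * (1 + T ^ 2)⁻¹ * |b - a|) atTop (nhds 0) := by
    have : Tendsto (fun T : ℝ ↦ (1 + T ^ 2)⁻¹) atTop (nhds 0) :=
      tendsto_inv_atTop_zero.comp
        (tendsto_atTop_add_const_left _ _ (tendsto_pow_atTop two_ne_zero))
    simpa using (this.const_mul C).mul_const |b - a|
  have hhor (f : ℝ → ℝ) (hf : ∀ T, f T ^ 2 = T ^ 2) :
      Tendsto (fun T : ℝ ↦ ∫ x in a..b, H (x + f T * Complex.I)) atTop (nhds 0) := by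
    refine squeeze_zero_norm (fun T ↦ ?_) hdecay
    refine intervalIntegral.norm_integral_le_of_norm_le_const fun x hx ↦ ?_
    rw [Set.uIoc_of_le hab] at hx
    have := hbound (x + f T * Complex.I) (by simpa using ⟨hx.1.le, hx.2⟩)
    simpa [hf] using this
  have hrect (T : ℝ) : (∫ x in a..b, H (x + (-T : ℝ) * Complex.I)) -
      (∫ x in a..b, H (x + T * Complex.I)) +
      Complex.I • (∫ t in (-T)..T, H (b + t * Complex.I)) -
      Complex.I • (∫ t in (-T)..T, H (a + t * Complex.I)) = 0 := by
    have := Complex.integral_boundary_rect_eq_zero_of_differentiableOn H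
      (a + (-T : ℝ) * Complex.I) (b + T * Complex.I) (hH.mono fun s hs ↦ by
        have := hs.1
        simpa [Set.uIcc_of_le hab] using this)
    simpa using this
  have ha : a ∈ Set.Icc a b := ⟨le_rfl, hab⟩
  have hb : b ∈ Set.Icc a b := ⟨hab, le_rfl⟩
  have htot := (((hhor (fun T ↦ -T) fun T ↦ by ring).sub (hhor (fun T ↦ T) fun T ↦ rfl)).add
    ((hlim b hb).const_smul Complex.I)).sub ((hlim a ha).const_smul Complex.I)
  simp only [hrect] at htot
  have h0 := tendsto_nhds_unique htot tendsto_const_nhds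
  simp only [sub_self, zero_add, smul_eq_mul, ← mul_sub, mul_eq_zero, Complex.I_ne_zero,
    false_or] at h0
  exact (sub_eq_zero.1 h0).symm

/-- The Gamma quotient in the Mellin–Barnes integral defining `Wk`. -/
noncomputable def WkMellin (k : ℕ) (s : ℂ) : ℂ :=
  Complex.Gamma (s + k - 1) * Complex.Gamma (s - 1 / 2) * (Complex.Gamma (2 - s))⁻¹

theorem differentiableAt_WkMellin (k : ℕ) {s : ℂ} (hs : 1 < s.re) :
    DifferentiableAt ℂ (WkMellin k) s := by
  have hG {z : ℂ} (hz : 0 < z.re) : DifferentiableAt ℂ Complex.Gamma z :=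
    Complex.differentiableAt_Gamma z fun m h ↦ by
      have : (0 : ℝ) ≤ m := m.cast_nonneg
      simp [h] at hz
      linarith
  have hk : (0 : ℝ) ≤ k := k.cast_nonneg
  have h1 : DifferentiableAt ℂ (fun s : ℂ ↦ Complex.Gamma (s + k - 1)) s :=
    DifferentiableAt.comp s (hG (z := s + k - 1) (by simp; linarith)) (by fun_prop)
  have h2 : DifferentiableAt ℂ (fun s : ℂ ↦ Complex.Gamma (s - 1 / 2)) s :=
    DifferentiableAt.comp s (hG (z := s - 1 / 2) (by simp; linarith)) (by fun_prop)
  have h3 : DifferentiableAt ℂ (fun s : ℂ ↦ (Complex.Gamma (2 - s))⁻¹) s :=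
    DifferentiableAt.comp (g := fun z : ℂ ↦ (Complex.Gamma z)⁻¹) s
      (Complex.differentiable_one_div_Gamma (2 - s)) (by fun_prop)
  exact (h1.mul h2).mul h3

theorem norm_WkMellin_le (k m : ℕ) {s : ℂ} (hk : 0 < k) (hs : 1 < s.re) (hm : 2 * s.re < m) :
    ‖WkMellin k s‖ ≤ (k + m + 2) ^ m * Real.Gamma (s.re + k + m + 1) * Real.Gamma (s.re - 1 / 2) *
      (Real.Gamma (2 - s.re + m))⁻¹ * (1 + s.im ^ 2)⁻¹ := by
  have hk1 : (1 : ℝ) ≤ k := by exact_mod_cast hk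
  set w : ℂ := s + k - 1 with hw
  have hwre : w.re = s.re + k - 1 := by simp [hw]
  have hwim : w.im = s.im := by simp [hw]
  have hw1 : 1 < w.re := by linarith
  have hwnorm : 1 ≤ ‖w‖ := hw1.le.trans (Complex.re_le_norm w)
  have hwsq : 1 + s.im ^ 2 ≤ ‖w‖ ^ 2 := by
    rw [Complex.sq_norm, Complex.normSq_apply, hwim]
    nlinarith
  have hG1 : ‖Complex.Gamma w‖ * ‖w‖ ^ (m + 2) ≤ Real.Gamma (s.re + k + m + 1) := by
    have := norm_Gamma_mul_norm_pow_le (w := w) (by linarith) (m + 2)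
    rw [hwre] at this
    convert this using 2
    push_cast
    ring
  have hprod : ‖∏ j ∈ Finset.range m, (2 - s + j)‖ ≤ (k + m + 2) ^ m * ‖w‖ ^ m := by
    rw [norm_prod, ← mul_pow]
    refine (Finset.prod_le_prod (g := fun _ ↦ (k + m + 2) * ‖w‖) (fun j _ ↦ norm_nonneg _)
      fun j hj ↦ ?_).trans_eq (by simp)
    have hj : (j : ℝ) ≤ m := by exact_mod_cast (Finset.mem_range.1 hj).le
    have : 2 - s + j = ((k + 1 + j : ℕ) : ℂ) - w := by rw [hw]; push_cast; ring
    calc ‖2 - s + j‖ ≤ ((k + 1 + j : ℕ) : ℝ) + ‖w‖ := by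
          rw [this]
          exact (norm_sub_le _ _).trans_eq (by rw [Complex.norm_natCast])
      _ ≤ (k + m + 2) * ‖w‖ := by
          push_cast
          nlinarith
  have hquot : ‖Complex.Gamma (s - 1 / 2)‖ * ‖(Complex.Gamma (2 - s + m))⁻¹‖ ≤
      Real.Gamma (s.re - 1 / 2) * (Real.Gamma (2 - s.re + m))⁻¹ := by
    have hre : ((starRingEnd ℂ) (s - 1 / 2)).re = s.re - 1 / 2 := by simp
    have h := norm_Gamma_mul_Gamma_add_le (u := (starRingEnd ℂ) (s - 1 / 2))
      (v := 5 / 2 - 2 * s.re + m) (by rw [hre]; linarith) (by linarith)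
    have harg : (starRingEnd ℂ) (s - 1 / 2) + ((5 / 2 - 2 * s.re + m : ℝ) : ℂ) = 2 - s + m := by
      apply Complex.ext
      · simp
        ring
      · simp
    rw [hre, harg, Complex.Gamma_conj, Complex.norm_conj,
      show s.re - 1 / 2 + (5 / 2 - 2 * s.re + m) = 2 - s.re + m by ring] at h
    have hpos : 0 < Real.Gamma (2 - s.re + m) := Real.Gamma_pos_of_pos (by linarith)
    have hpos' : 0 < ‖Complex.Gamma (2 - s + m)‖ :=
      norm_pos_iff.2 (Complex.Gamma_ne_zero_of_re_pos (by simp; linarith))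
    rw [norm_inv, ← div_eq_mul_inv, ← div_eq_mul_inv, div_le_div_iff₀ hpos' hpos]
    linarith
  have hΓ1 : 0 ≤ Real.Gamma (s.re + k + m + 1) := (Real.Gamma_pos_of_pos (by positivity)).le
  rw [WkMellin, ← hw, inv_Gamma_eq_prod_mul (2 - s) m]
  simp only [norm_mul]
  calc ‖Complex.Gamma w‖ * ‖Complex.Gamma (s - 1 / 2)‖ *
        (‖∏ j ∈ Finset.range m, (2 - s + j)‖ * ‖(Complex.Gamma (2 - s + m))⁻¹‖)
      = ‖Complex.Gamma w‖ * ‖∏ j ∈ Finset.range m, (2 - s + j)‖ *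
        (‖Complex.Gamma (s - 1 / 2)‖ * ‖(Complex.Gamma (2 - s + m))⁻¹‖) := by ring
    _ ≤ ‖Complex.Gamma w‖ * ((k + m + 2) ^ m * ‖w‖ ^ m) *
        (Real.Gamma (s.re - 1 / 2) * (Real.Gamma (2 - s.re + m))⁻¹) := by gcongr
    _ = (k + m + 2) ^ m * (‖Complex.Gamma w‖ * ‖w‖ ^ (m + 2)) * (‖w‖ ^ 2)⁻¹ *
        (Real.Gamma (s.re - 1 / 2) * (Real.Gamma (2 - s.re + m))⁻¹) := by
      have : ‖w‖ ≠ 0 := by positivity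
      rw [pow_add]
      field_simp
    _ ≤ (k + m + 2) ^ m * Real.Gamma (s.re + k + m + 1) * (1 + s.im ^ 2)⁻¹ *
        (Real.Gamma (s.re - 1 / 2) * (Real.Gamma (2 - s.re + m))⁻¹) := by
      have h1 : 0 ≤ Real.Gamma (s.re - 1 / 2) := (Real.Gamma_pos_of_pos (by linarith)).le
      have h2 : 0 ≤ Real.Gamma (2 - s.re + m) := (Real.Gamma_pos_of_pos (by linarith)).le
      gcongr
    _ = _ := by ring

theorem exists_norm_WkMellin_le (k : ℕ) (hk : 0 < k) {a b : ℝ} (ha : 1 < a) :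
    ∃ C, 0 ≤ C ∧ ∀ s : ℂ, s.re ∈ Set.Icc a b → ‖WkMellin k s‖ ≤ C * (1 + s.im ^ 2)⁻¹ := by
  obtain ⟨m, hm⟩ := exists_nat_gt (2 * b)
  have hcomp (f : ℝ → ℝ) (hf : Continuous f) (hpos : ∀ x ∈ Set.Icc a b, 0 < f x) :
      ContinuousOn (fun x ↦ Real.Gamma (f x)) (Set.Icc a b) :=
    Real.differentiableOn_Gamma_Ioi.continuousOn.comp hf.continuousOn hpos
  have hcont : ContinuousOn (fun x : ℝ ↦ ((k : ℝ) + m + 2) ^ m * Real.Gamma (x + k + m + 1) *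
      Real.Gamma (x - 1 / 2) * (Real.Gamma (2 - x + m))⁻¹) (Set.Icc a b) := by
    refine ((continuousOn_const.mul (hcomp _ (by fun_prop) fun x hx ↦ ?_)).mul
      (hcomp _ (by fun_prop) fun x hx ↦ ?_)).mul
      ((hcomp _ (by fun_prop) fun x hx ↦ ?_).inv₀ fun x hx ↦ ?_)
    · have : 0 < x := by linarith [hx.1]
      positivity
    · linarith [hx.1]
    · linarith [hx.1, hx.2]
    · exact (Real.Gamma_pos_of_pos (by linarith [hx.1, hx.2])).ne'
  obtain ⟨C, hC⟩ := isCompact_Icc.exists_bound_of_continuousOn hcont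
  refine ⟨max C 0, le_max_right _ _, fun s hs ↦ ?_⟩
  refine (norm_WkMellin_le k m hk (by linarith [hs.1]) (by linarith [hs.2])).trans ?_
  gcongr
  exact ((le_abs_self _).trans (hC _ hs)).trans (le_max_left _ _)

/-- The kernel `Wk` decays faster than any power. -/
theorem exists_norm_Wk_le (k : ℕ) (hk : 0 < k) {b : ℝ} (hb : 5 / 4 ≤ b) :
    ∃ C, 0 ≤ C ∧ ∀ x : ℝ, 0 < x → ‖Wk k x‖ ≤ C * x ^ (-b) := by
  obtain ⟨C, hC0, hC⟩ := exists_norm_WkMellin_le k hk (a := 5 / 4) (b := b) (by norm_num)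
  refine ⟨‖(1 / (2 * Real.pi) : ℂ)‖ * (C * Real.pi), by positivity, fun x hx ↦ ?_⟩
  have hnorm (s : ℂ) (hs : s.re ∈ Set.Icc (5 / 4) b) : ‖WkMellin k s * (x : ℂ) ^ (-s)‖ ≤
      C * x ^ (-s.re) * (1 + s.im ^ 2)⁻¹ := by
    rw [norm_mul, Complex.norm_cpow_eq_rpow_re_of_pos hx, Complex.neg_re, mul_right_comm]
    gcongr
    exact hC s hs
  have hcont : ContinuousOn (fun y : ℝ ↦ x ^ (-y)) (Set.Icc (5 / 4) b) :=
    (continuous_const.rpow continuous_neg fun _ ↦ .inl hx.ne').continuousOn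
  obtain ⟨D, hD⟩ := isCompact_Icc.exists_bound_of_continuousOn hcont
  have hshift := integral_vertical_eq_of_norm_le (H := fun s ↦ WkMellin k s * (x : ℂ) ^ (-s))
    (C := C * D) hb (fun s hs ↦ by
      have h1 : 1 < s.re := by linarith [hs.1]
      refine ((differentiableAt_WkMellin k h1).mul ?_).differentiableWithinAt
      exact differentiableAt_id.neg.const_cpow (.inl (by exact_mod_cast hx.ne')))
    fun s hs ↦ (hnorm s hs).trans (by
      gcongr
      exact (le_abs_self _).trans (hD _ hs))
  have hWk : Wk k x = (1 / (2 * Real.pi)) *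
      ∫ t : ℝ, WkMellin k (b + t * Complex.I) * (x : ℂ) ^ (-(b + t * Complex.I)) := by
    rw [Wk, ← hshift]
    congr 2
    funext t
    rw [WkMellin]
    push_cast
    congr 1
    ring_nf
  rw [hWk, norm_mul, mul_assoc]
  gcongr
  calc ‖∫ t : ℝ, WkMellin k (b + t * Complex.I) * (x : ℂ) ^ (-(b + t * Complex.I))‖
      ≤ ∫ t : ℝ, C * x ^ (-b) * (1 + t ^ 2)⁻¹ := by
        refine norm_integral_le_of_norm_le (integrable_inv_one_add_sq.const_mul _)
          (.of_forall fun t ↦ ?_)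
        simpa using hnorm (b + t * Complex.I) (by simpa using hb)
    _ = C * Real.pi * x ^ (-b) := by
        rw [integral_const_mul, integral_univ_inv_one_add_sq]
        ring

/-- `c_f` decays faster than any polynomial at infinity. -/
theorem cf_rapid_decay (k : ℕ) (hk : Even k) (hk0 : 0 < k)
    (lam : ℕ → ℝ) (hlam1 : lam 1 = 1)
    (hHecke : ∀ m n : ℕ, 0 < m → 0 < n →
      lam m * lam n = ∑ d ∈ (Nat.gcd m n).divisors, lam (m * n / d ^ 2))
    (hDeligne : ∀ n : ℕ, 0 < n → |lam n| ≤ (n.divisors.card : ℝ)) :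
    ∀ N : ℕ, 0 < N → ∃ C > (0:ℝ), ∀ α : ℝ, 1 ≤ α →
      ‖cf k lam α‖ ≤ C * α ^ (-(N : ℝ)) := by
  intro N _
  have hN : (0 : ℝ) ≤ N := N.cast_nonneg
  obtain ⟨C, hC0, hC⟩ := exists_norm_Wk_le k hk0 (b := N + 4) (by linarith)
  have hsum : Summable fun n : ℕ+ ↦ C * (1 / ((n : ℕ) : ℝ) ^ 2) :=
    ((Real.summable_one_div_nat_pow.2 one_lt_two).comp_injective PNat.coe_injective).mul_left C
  set S := ∑' n : ℕ+, C * (1 / ((n : ℕ) : ℝ) ^ 2)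
  have hS : 0 ≤ S := tsum_nonneg fun n ↦ by positivity
  refine ⟨Real.pi ^ ((3 : ℝ) / 2) / 2 * S + 1, by positivity, fun α hα ↦ ?_⟩
  have hα0 : 0 < α := by linarith
  have hterm (n : ℕ+) : ‖((lam n ^ 2 : ℝ) : ℂ) * Wk k (Real.pi ^ 2 * (n : ℕ) * α)‖ ≤
      C * (1 / ((n : ℕ) : ℝ) ^ 2) * α ^ (-(N + 4 : ℝ)) := by
    have hn : (1 : ℝ) ≤ (n : ℕ) := by exact_mod_cast n.pos
    have hlam : lam n ^ 2 ≤ ((n : ℕ) : ℝ) ^ 2 := sq_le_sq.2 <| by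
      rw [Nat.abs_cast]
      exact (hDeligne n n.pos).trans (by exact_mod_cast Nat.card_divisors_le_self n)
    have hpi : 1 ≤ Real.pi ^ 2 := one_le_pow₀ (by linarith [Real.pi_gt_three])
    have hW : ‖Wk k (Real.pi ^ 2 * (n : ℕ) * α)‖ ≤
        C * (((n : ℕ) : ℝ) ^ (-4 : ℝ) * α ^ (-(N + 4 : ℝ))) := by
      refine (hC _ (by positivity)).trans ?_
      gcongr
      calc (Real.pi ^ 2 * (n : ℕ) * α) ^ (-(N + 4 : ℝ)) ≤ ((n : ℕ) * α) ^ (-(N + 4 : ℝ)) := by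
            refine Real.rpow_le_rpow_of_nonpos (by positivity) ?_ (by linarith)
            rw [mul_assoc]
            exact le_mul_of_one_le_left (by positivity) hpi
        _ = ((n : ℕ) : ℝ) ^ (-(N + 4 : ℝ)) * α ^ (-(N + 4 : ℝ)) :=
            Real.mul_rpow (by positivity) hα0.le
        _ ≤ ((n : ℕ) : ℝ) ^ (-4 : ℝ) * α ^ (-(N + 4 : ℝ)) := by
            gcongr
            linarith
    rw [norm_mul, Complex.norm_real, Real.norm_eq_abs, abs_of_nonneg (sq_nonneg _)]
    calc lam n ^ 2 * ‖Wk k (Real.pi ^ 2 * (n : ℕ) * α)‖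
        ≤ ((n : ℕ) : ℝ) ^ 2 * (C * (((n : ℕ) : ℝ) ^ (-4 : ℝ) * α ^ (-(N + 4 : ℝ)))) := by gcongr
      _ = C * (1 / ((n : ℕ) : ℝ) ^ 2) * α ^ (-(N + 4 : ℝ)) := by
        rw [show (-4 : ℝ) = -((4 : ℕ) : ℝ) by norm_num, Real.rpow_neg (by positivity),
          Real.rpow_natCast]
        field_simp
  have htsum := tsum_of_norm_bounded (hsum.hasSum.mul_right (α ^ (-(N + 4 : ℝ)))) hterm
  rw [cf, norm_mul, Complex.norm_real, Real.norm_of_nonneg (by positivity)]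
  calc Real.pi ^ ((3 : ℝ) / 2) / 2 * α * _
      ≤ Real.pi ^ ((3 : ℝ) / 2) / 2 * α * (S * α ^ (-(N + 4 : ℝ))) := by gcongr
    _ = Real.pi ^ ((3 : ℝ) / 2) / 2 * S * α ^ (1 + -(N + 4 : ℝ)) := by
        rw [Real.rpow_add hα0, Real.rpow_one]
        ring
    _ ≤ (Real.pi ^ ((3 : ℝ) / 2) / 2 * S + 1) * α ^ (-(N : ℝ)) := by
        gcongr
        · linarith
        · linarith
end

section
/- For every ε > 0 there exists a constant C > 0 such that for all real numbers X, Y with 2 ≤ Y ≤ X one has | ∑_{1≤m≤Y, m odd} ∑_{1≤n≤X, n odd} (n/m) − (2/π²) X Y^(1/2) | ≤ C ( Y^(3/2) log Y + Y^(1/2) X^ε + X log Y ), where (n/m) denotes the Jacobi symbol. -/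
open Finset

/-- An exponential sum over an initial segment with frequency `k / N` is at most `1 / sin (π k / N)`,
hence bounded by the inverse distance of `k / N` to the integers. -/
theorem norm_sum_range_stdAddChar_mul_le {N : ℕ} [NeZero N] {k : ℕ} (hk : 0 < k) (hkN : k < N)
    (M : ℕ) :
    ‖∑ n ∈ range M, ZMod.stdAddChar ((n : ZMod N) * (k : ZMod N))‖ ≤
      (N / 2 : ℝ) * ((k : ℝ)⁻¹ + ((N - k : ℕ) : ℝ)⁻¹) := by
  have hN0 : (0 : ℝ) < N := by exact_mod_cast hk.trans hkN
  have hk0 : (0 : ℝ) < k := by exact_mod_cast hk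
  have hkN' : (k : ℝ) < N := by exact_mod_cast hkN
  set z : ℂ := ZMod.stdAddChar (k : ZMod N) with hz
  have hz1 : ‖z‖ = 1 := by rw [hz, ZMod.stdAddChar_apply]; exact Circle.norm_coe _
  have hsum : ∑ n ∈ range M, ZMod.stdAddChar ((n : ZMod N) * (k : ZMod N)) =
      ∑ n ∈ range M, z ^ n := by
    refine sum_congr rfl fun n _ => ?_
    rw [hz, ← AddChar.map_nsmul_eq_pow, nsmul_eq_mul]
  set t : ℝ := k / N with ht
  have ht0 : 0 < t := by positivity
  have ht1 : t < 1 := (div_lt_one hN0).2 hkN'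
  have hz2 : z = Complex.exp (Complex.I * ((2 * Real.pi * t : ℝ) : ℂ)) := by
    rw [hz, ZMod.stdAddChar_apply, ZMod.toCircle_natCast, ht]
    congr 1
    push_cast
    ring
  have hpi := Real.pi_pos
  have hz3 : ‖z - 1‖ = 2 * |Real.sin (Real.pi * t)| := by
    rw [hz2, Complex.norm_exp_I_mul_ofReal_sub_one, Real.norm_eq_abs, abs_mul, abs_two]
    ring_nf
  have hsin : 2 * t * (1 - t) ≤ |Real.sin (Real.pi * t)| := by
    refine le_trans ?_ (le_abs_self _)
    rcases le_total t (1 / 2) with h | h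
    · have := Real.mul_le_sin (x := Real.pi * t) (by positivity) (by nlinarith)
      have e : 2 / Real.pi * (Real.pi * t) = 2 * t := by field_simp
      nlinarith
    · have := Real.mul_le_sin (x := Real.pi * (1 - t)) (by nlinarith) (by nlinarith)
      have e : 2 / Real.pi * (Real.pi * (1 - t)) = 2 * (1 - t) := by field_simp
      have e' : Real.sin (Real.pi * (1 - t)) = Real.sin (Real.pi * t) := by
        rw [mul_sub, mul_one, Real.sin_pi_sub]
      rw [e, e'] at this
      nlinarith
  have hpos : 0 < 2 * t * (1 - t) := by nlinarith [mul_pos ht0 (sub_pos.2 ht1)]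
  have hne : z ≠ 1 := by
    intro h
    rw [h, sub_self, norm_zero] at hz3
    linarith
  rw [hsum, geom_sum_eq hne, norm_div, hz3]
  have hnum : ‖z ^ M - 1‖ ≤ 2 := by
    refine (norm_sub_le _ _).trans ?_
    rw [norm_pow, hz1]
    norm_num
  calc ‖z ^ M - 1‖ / (2 * |Real.sin (Real.pi * t)|) ≤ 2 / (2 * (2 * t * (1 - t))) := by gcongr
    _ = (N / 2 : ℝ) * ((k : ℝ)⁻¹ + ((N - k : ℕ) : ℝ)⁻¹) := by
      rw [Nat.cast_sub hkN.le, ht]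
      have : (N : ℝ) - k ≠ 0 := by linarith
      field_simp
      ring

theorem sum_Ioo_inv_add_inv_sub_le (N : ℕ) :
    ∑ k ∈ Ioo 0 N, ((k : ℝ)⁻¹ + ((N - k : ℕ) : ℝ)⁻¹) ≤ 2 * (1 + Real.log N) := by
  have hrefl : ∑ k ∈ Ioo 0 N, ((N - k : ℕ) : ℝ)⁻¹ = ∑ k ∈ Ioo 0 N, (k : ℝ)⁻¹ := by
    refine sum_nbij' (fun k => N - k) (fun k => N - k) ?_ ?_ ?_ ?_ (fun _ _ => rfl) <;>
      simp only [mem_Ioo] <;> omega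
  have hle : ∑ k ∈ Ioo 0 N, (k : ℝ)⁻¹ ≤ 1 + Real.log N := by
    have h := harmonic_le_one_add_log N
    rw [harmonic_eq_sum_Icc] at h
    push_cast at h
    refine le_trans (sum_le_sum_of_subset_of_nonneg ?_ fun _ _ _ => by positivity) h
    intro k
    simp only [mem_Ioo, mem_Icc]
    omega
  rw [sum_add_distrib, hrefl]
  linarith

open ZMod in
/-- The completion step of the Pólya–Vinogradov inequality: a function on `ZMod N` of mean zero
whose Fourier transform is bounded by `B` has initial sums bounded by `B (1 + log N)`. -/
theorem norm_sum_range_le_of_norm_dft_le {N : ℕ} [NeZero N] (Φ : ZMod N → ℂ) {B : ℝ}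
    (h0 : 𝓕 Φ 0 = 0) (hB : ∀ k, ‖𝓕 Φ k‖ ≤ B) (M : ℕ) :
    ‖∑ n ∈ range M, Φ n‖ ≤ B * (1 + Real.log N) := by
  have hN : 0 < N := Nat.pos_of_ne_zero (NeZero.ne N)
  have hN0 : (0 : ℝ) < N := by exact_mod_cast hN
  have hB0 : 0 ≤ B := (norm_nonneg _).trans (hB 0)
  have hinv (j : ZMod N) : Φ j = (N : ℂ)⁻¹ * ∑ k, stdAddChar (j * k) * 𝓕 Φ k := by
    conv_lhs => rw [← dft.symm_apply_apply Φ]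
    rw [invDFT_apply]
    simp only [smul_eq_mul, mul_comm j]
  have hswap : ∑ n ∈ range M, Φ n = (N : ℂ)⁻¹ *
      ∑ k : ZMod N, 𝓕 Φ k * ∑ n ∈ range M, stdAddChar ((n : ZMod N) * k) := by
    simp only [mul_sum]
    rw [sum_comm]
    refine sum_congr rfl fun n _ => ?_
    rw [hinv, mul_sum]
    refine sum_congr rfl fun k _ => by ring
  have hreindex (f : ZMod N → ℂ) (hf : f 0 = 0) : ∑ k, f k = ∑ k ∈ Ioo 0 N, f (k : ℕ) := by
    rw [← sum_subset (subset_univ (univ.erase (0 : ZMod N))) (f := f)]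
    · symm
      refine sum_bij' (fun k _ => (k : ZMod N)) (fun k _ => k.val) ?_ ?_ ?_ ?_ ?_
      · intro k hk
        rw [mem_Ioo] at hk
        simp only [mem_erase, mem_univ, and_true, ne_eq, ZMod.natCast_eq_zero_iff]
        exact Nat.not_dvd_of_pos_of_lt hk.1 hk.2
      · intro k hk
        simp only [mem_erase, mem_univ, and_true] at hk
        rw [mem_Ioo]
        exact ⟨Nat.pos_of_ne_zero ((ZMod.val_ne_zero k).2 hk), ZMod.val_lt k⟩
      · intro k hk
        rw [mem_Ioo] at hk
        exact ZMod.val_cast_of_lt hk.2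
      · intro k _
        exact ZMod.natCast_zmod_val k
      · intros; rfl
    · intro k _ hk
      rw [show k = 0 by simpa using hk, hf]
  rw [hswap, hreindex _ (by rw [h0, zero_mul]), norm_mul, norm_inv, Complex.norm_natCast]
  calc (N : ℝ)⁻¹ * ‖∑ k ∈ Ioo 0 N, 𝓕 Φ (k : ℕ) *
        ∑ n ∈ range M, stdAddChar ((n : ZMod N) * ((k : ℕ) : ZMod N))‖
      ≤ (N : ℝ)⁻¹ * ∑ k ∈ Ioo 0 N, B * ((N / 2 : ℝ) * ((k : ℝ)⁻¹ + ((N - k : ℕ) : ℝ)⁻¹)) := by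
        gcongr
        refine (norm_sum_le _ _).trans (sum_le_sum fun k hk => ?_)
        rw [mem_Ioo] at hk
        rw [norm_mul]
        gcongr
        · exact hB _
        · exact norm_sum_range_stdAddChar_mul_le hk.1 hk.2 M
    _ = B / 2 * ∑ k ∈ Ioo 0 N, ((k : ℝ)⁻¹ + ((N - k : ℕ) : ℝ)⁻¹) := by
        rw [← mul_sum, ← mul_sum]
        field_simp
    _ ≤ B / 2 * (2 * (1 + Real.log N)) := by
        gcongr
        exact sum_Ioo_inv_add_inv_sub_le N
    _ = B * (1 + Real.log N) := by ring

open ZMod in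
/-- The Gauss sum of a primitive real character modulo `N` has absolute value `√N`. -/
theorem DirichletCharacter.IsPrimitive.norm_gaussSum_of_isQuadratic {N : ℕ} [NeZero N]
    {χ : DirichletCharacter ℂ N} (hχ : χ.IsPrimitive) (hq : χ.IsQuadratic) :
    ‖gaussSum χ stdAddChar‖ = Real.sqrt N := by
  have hinv : χ⁻¹ = χ := hq.inv
  set τ := gaussSum χ stdAddChar with hτ
  have h1 : 𝓕 (χ : ZMod N → ℂ) = fun k => χ (-k) * τ := by
    ext k
    rw [hχ.fourierTransform_eq_inv_mul_gaussSum, hinv]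
  have h2 := congrFun (dft_dft (χ : ZMod N → ℂ)) 1
  have h3 : 𝓕 (fun k => χ (-k) * τ) 1 = τ * τ := by
    rw [dft_mul_const, dft_comp_neg (χ : ZMod N → ℂ)]
    simp [h1]
  rw [h1, h3] at h2
  have h4 : ‖τ‖ * ‖τ‖ = N := by
    have h5 : ‖χ (-1)‖ = 1 := by simpa using χ.unit_norm_eq_one (-1)
    rw [← norm_mul, h2, smul_eq_mul, norm_mul, h5, Complex.norm_natCast, mul_one]
  rw [← h4, Real.sqrt_mul_self (norm_nonneg _)]

/-- The Pólya–Vinogradov inequality for primitive real characters. -/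
theorem DirichletCharacter.IsPrimitive.norm_sum_range_le_of_isQuadratic {N : ℕ} (hN : 1 < N)
    {χ : DirichletCharacter ℂ N} (hχ : χ.IsPrimitive) (hq : χ.IsQuadratic) (M : ℕ) :
    ‖∑ n ∈ range M, χ n‖ ≤ Real.sqrt N * (1 + Real.log N) := by
  have : NeZero N := ⟨by omega⟩
  have : Fact (1 < N) := ⟨hN⟩
  refine norm_sum_range_le_of_norm_dft_le _ ?_ (fun k => ?_) M
  · rw [hχ.fourierTransform_eq_inv_mul_gaussSum, neg_zero, MulChar.map_zero, zero_mul]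
  · rw [hχ.fourierTransform_eq_inv_mul_gaussSum, norm_mul, hχ.norm_gaussSum_of_isQuadratic hq]
    exact mul_le_of_le_one_left (Real.sqrt_nonneg _) (DirichletCharacter.norm_le_one _ _)

/-- The Jacobi symbol `a ↦ J(a | N)` as a Dirichlet character modulo `N`. -/
noncomputable def jacobiChar (N : ℕ) [NeZero N] : DirichletCharacter ℂ N where
  toFun a := (jacobiSym (a.val : ℤ) N : ℂ)
  map_one' := by
    rw [ZMod.val_one_eq_one_mod, Int.natCast_mod, ← jacobiSym.mod_left]
    simp
  map_mul' a b := by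
    rw [ZMod.val_mul, Int.natCast_mod, ← jacobiSym.mod_left, Nat.cast_mul, jacobiSym.mul_left]
    push_cast
    rfl
  map_nonunit' a ha := by
    have h : ¬ Nat.Coprime a.val N := by
      rwa [← ZMod.natCast_zmod_val a, ZMod.isUnit_iff_coprime] at ha
    have : jacobiSym (a.val : ℤ) N = 0 := by
      rw [jacobiSym.eq_zero_iff_not_coprime, Int.gcd_natCast_natCast]
      exact h
    exact_mod_cast this

theorem jacobiChar_natCast (N : ℕ) [NeZero N] (n : ℕ) :
    jacobiChar N (n : ZMod N) = (jacobiSym n N : ℂ) := by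
  change (jacobiSym ((n : ZMod N).val : ℤ) N : ℂ) = _
  rw [ZMod.val_natCast, Int.natCast_mod, ← jacobiSym.mod_left]

theorem jacobiChar_isQuadratic (N : ℕ) [NeZero N] : (jacobiChar N).IsQuadratic := by
  intro a
  change (jacobiSym (a.val : ℤ) N : ℂ) = 0 ∨ (jacobiSym (a.val : ℤ) N : ℂ) = 1 ∨
    (jacobiSym (a.val : ℤ) N : ℂ) = -1
  exact_mod_cast jacobiSym.trichotomy _ _

theorem jacobiChar_isPrimitive {N : ℕ} [NeZero N] (hodd : Odd N) (hsq : Squarefree N) :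
    (jacobiChar N).IsPrimitive := by
  by_contra hprim
  set χ := jacobiChar N with hχ
  obtain ⟨c, hc⟩ := χ.conductor_dvd_level
  have hc1 : c ≠ 1 := by
    rintro rfl
    exact hprim (by rw [DirichletCharacter.isPrimitive_def]; simpa using hc.symm)
  obtain ⟨p, hp, q, rfl⟩ := Nat.exists_prime_and_dvd hc1
  have : Fact p.Prime := ⟨hp⟩
  set d := χ.conductor with hd
  have hN : N = p * (d * q) := by rw [hc]; ring
  have hcop : Nat.Coprime p (d * q) := Nat.coprime_of_squarefree_mul (hN ▸ hsq)
  have hp2 : p ≠ 2 := by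
    rintro rfl
    rw [hN] at hodd
    exact (Nat.not_odd_iff_even.2 (even_two_mul _)) hodd
  have hdq : d * q ≠ 0 := by
    intro h
    rw [h, mul_zero] at hN
    exact NeZero.ne N hN
  obtain ⟨a, ha⟩ := FiniteField.exists_nonsquare (F := ZMod p) (by rwa [ZMod.ringChar_zmod_n])
  obtain ⟨b, hb1, hb2⟩ := Nat.chineseRemainder hcop a.val 1
  have hJp : jacobiSym b p = -1 := by
    have : ((b : ℤ) : ZMod p) = a := by
      rw [Int.cast_natCast, (ZMod.natCast_eq_natCast_iff _ _ _).2 hb1, ZMod.natCast_zmod_val]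
    exact ZMod.nonsquare_iff_jacobiSym_eq_neg_one.2 (by rwa [this])
  have hJq : jacobiSym b (d * q) = 1 := by
    rw [jacobiSym.mod_left' (a₂ := 1), jacobiSym.one_left]
    exact_mod_cast hb2
  have hJ : jacobiSym b N = -1 := by
    rw [hN, jacobiSym.mul_right' _ hp.ne_zero hdq, hJp, hJq]
    norm_num
  have hcopN : Nat.Coprime b N := by
    by_contra h
    have : jacobiSym b N = 0 := by
      rw [jacobiSym.eq_zero_iff_not_coprime, Int.gcd_natCast_natCast]
      exact h
    omega
  have hχb : χ (b : ℤ) = -1 := by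
    have := jacobiChar_natCast N b
    rw [hJ] at this
    push_cast at this ⊢
    exact this
  obtain ⟨hdN, χ₀, h⟩ := χ.factorsThrough_conductor
  have hbd : ((b : ℤ) : ZMod d) = 1 := by
    have := (ZMod.natCast_eq_natCast_iff _ _ _).2 (hb2.of_mul_right q)
    simpa using this
  rw [h, DirichletCharacter.changeLevel_eq_cast_of_dvd' χ₀ hdN (Nat.isCoprime_iff_coprime.2 hcopN),
    hbd, map_one] at hχb
  norm_num at hχb

theorem Finset.sum_Icc_filter_dvd {R : Type*} [AddCommMonoid R] (f : ℕ → R) {d : ℕ}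
    (hd : 0 < d) (M : ℕ) :
    ∑ n ∈ (Icc 1 M).filter (fun n => d ∣ n), f n = ∑ k ∈ Icc 1 (M / d), f (d * k) := by
  symm
  refine sum_nbij' (fun k => d * k) (fun n => n / d) ?_ ?_ ?_ ?_ ?_
  · intro k hk
    rw [mem_Icc] at hk
    simp only [mem_filter, mem_Icc, dvd_mul_right, and_true]
    exact ⟨Nat.mul_pos hd hk.1, (Nat.mul_le_mul_left d hk.2).trans (Nat.mul_div_le M d)⟩
  · intro n hn
    simp only [mem_filter, mem_Icc] at hn ⊢
    exact ⟨Nat.div_pos (Nat.le_of_dvd hn.1.1 hn.2) hd, Nat.div_le_div_right hn.1.2⟩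
  · intro k _
    exact Nat.mul_div_cancel_left k hd
  · intro n hn
    exact Nat.mul_div_cancel' (mem_filter.1 hn).2
  · intros; rfl

theorem sum_moebius_filter_dvd_eq_ite_coprime {r : ℕ} (hr : r ≠ 0) (n : ℕ) :
    ∑ d ∈ r.divisors.filter (fun d => d ∣ n), ArithmeticFunction.moebius d =
      if n.Coprime r then 1 else 0 := by
  have h : r.divisors.filter (fun d => d ∣ n) = (n.gcd r).divisors := by
    ext d
    simp only [mem_filter, Nat.mem_divisors, Nat.dvd_gcd_iff]
    have : n.gcd r ≠ 0 := Nat.gcd_ne_zero_right hr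
    tauto
  rw [h, ← ArithmeticFunction.coe_mul_zeta_apply, ArithmeticFunction.moebius_mul_coe_zeta,
    ArithmeticFunction.one_apply]

theorem abs_sum_Icc_jacobiSym_le_of_squarefree {a : ℕ} (hodd : Odd a) (hsq : Squarefree a)
    (ha : a ≠ 1) (M : ℕ) :
    |∑ n ∈ Icc 1 M, (jacobiSym n a : ℝ)| ≤ Real.sqrt a * (1 + Real.log a) := by
  have ha1 : 1 < a := by have := hodd.pos; omega
  have : NeZero a := ⟨by omega⟩
  have h := (jacobiChar_isPrimitive hodd hsq).norm_sum_range_le_of_isQuadratic ha1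
    (jacobiChar_isQuadratic a) (M + 1)
  have e : ∑ n ∈ range (M + 1), jacobiChar a (n : ZMod a) =
      ((∑ n ∈ Icc 1 M, (jacobiSym n a : ℝ) : ℝ) : ℂ) := by
    rw [range_eq_Ico, sum_eq_sum_Ico_succ_bot (Nat.succ_pos M), jacobiChar_natCast]
    have h0 : jacobiSym ((0 : ℕ) : ℤ) a = 0 := jacobiSym.zero_left ha1
    rw [h0, Int.cast_zero, zero_add]
    push_cast
    exact sum_congr rfl fun n _ => jacobiChar_natCast a n
  rwa [e, Complex.norm_real, Real.norm_eq_abs] at h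

/-- A Pólya–Vinogradov bound for the Jacobi symbol modulo an arbitrary odd nonsquare, summed over
odd integers. -/
theorem abs_sum_Icc_filter_odd_jacobiSym_le {m : ℕ} (hodd : Odd m) (hm : ¬ IsSquare m) (M : ℕ) :
    |∑ n ∈ (Icc 1 M).filter (fun n => Odd n), (jacobiSym n m : ℝ)| ≤
      2 * Real.sqrt m * (1 + Real.log m) := by
  obtain ⟨a, b, hab, hsq⟩ := Nat.sq_mul_squarefree m
  have hm0 : 0 < m := hodd.pos
  have hb0 : b ≠ 0 := by rintro rfl; simp at hab; omega
  have ha0 : a ≠ 0 := hsq.ne_zero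
  have hao : Odd a := by
    rw [← hab] at hodd
    exact (Nat.odd_mul.1 hodd).2
  have ha1 : a ≠ 1 := by
    rintro rfl
    exact hm ⟨b, by rw [← hab]; ring⟩
  have hr : 2 * b ≠ 0 := by omega
  have hJ (n : ℕ) (hn : Odd n) : (jacobiSym n m : ℝ) =
      ((if n.Coprime (2 * b) then 1 else 0 : ℤ) : ℝ) * jacobiSym n a := by
    have : NeZero b := ⟨hb0⟩
    rw [← hab, jacobiSym.mul_right' _ (pow_ne_zero 2 hb0) ha0, jacobiSym.pow_right]
    by_cases h : n.Coprime b
    · rw [jacobiSym.sq_one (by rwa [Int.gcd_natCast_natCast]), if_pos]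
      · push_cast; ring
      · exact Nat.Coprime.mul_right (Nat.coprime_two_right.2 hn) h
    · rw [jacobiSym.eq_zero_iff_not_coprime.2 (by rwa [Int.gcd_natCast_natCast]), if_neg]
      · push_cast; ring
      · exact fun h' => h (Nat.Coprime.coprime_mul_left_right h')
  have hsum : ∑ n ∈ (Icc 1 M).filter (fun n => Odd n), (jacobiSym n m : ℝ) =
      ∑ d ∈ (2 * b).divisors, (ArithmeticFunction.moebius d : ℝ) * ((jacobiSym d a : ℝ) *
        ∑ k ∈ Icc 1 (M / d), (jacobiSym k a : ℝ)) := by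
    calc _ = ∑ n ∈ Icc 1 M,
          ((if n.Coprime (2 * b) then 1 else 0 : ℤ) : ℝ) * (jacobiSym n a : ℝ) := by
          rw [sum_filter]
          refine sum_congr rfl fun n _ => ?_
          split_ifs with h h' h'
          · rw [hJ n h, if_pos h']
          · rw [hJ n h, if_neg h']
          · exact absurd (Nat.coprime_two_right.1 (Nat.Coprime.coprime_mul_right_right h')) h
          · simp
      _ = ∑ n ∈ Icc 1 M, ∑ d ∈ (2 * b).divisors,
          if d ∣ n then (ArithmeticFunction.moebius d : ℝ) * (jacobiSym n a : ℝ) else 0 := by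
          refine sum_congr rfl fun n _ => ?_
          rw [← sum_moebius_filter_dvd_eq_ite_coprime hr, ← sum_filter, Int.cast_sum, sum_mul]
      _ = _ := by
          rw [sum_comm]
          refine sum_congr rfl fun d hd => ?_
          rw [← sum_filter, sum_Icc_filter_dvd _ (Nat.pos_of_mem_divisors hd), mul_sum, mul_sum]
          refine sum_congr rfl fun k _ => ?_
          rw [Nat.cast_mul, jacobiSym.mul_left, Int.cast_mul]
  have hlog : Real.log a ≤ Real.log m := by
    refine Real.log_le_log (by exact_mod_cast Nat.pos_of_ne_zero ha0) ?_
    exact_mod_cast Nat.le_of_dvd hm0 ⟨b ^ 2, by rw [← hab]; ring⟩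
  have hlog0 : 0 ≤ Real.log a := Real.log_natCast_nonneg a
  have hterm (d : ℕ) : |(ArithmeticFunction.moebius d : ℝ) * ((jacobiSym d a : ℝ) *
        ∑ k ∈ Icc 1 (M / d), (jacobiSym k a : ℝ))| ≤ Real.sqrt a * (1 + Real.log m) := by
    have h1 : |(ArithmeticFunction.moebius d : ℝ)| ≤ 1 := by
      exact_mod_cast ArithmeticFunction.abs_moebius_le_one
    have h2 : |(jacobiSym d a : ℝ)| ≤ 1 := by
      rcases jacobiSym.trichotomy d a with h | h | h <;> rw [h] <;> norm_num
    rw [abs_mul, abs_mul]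
    calc _ ≤ 1 * (1 * (Real.sqrt a * (1 + Real.log a))) := by
          gcongr
          exact abs_sum_Icc_jacobiSym_le_of_squarefree hao hsq ha1 _
      _ ≤ _ := by
          rw [one_mul, one_mul]
          gcongr
  have hsqrt : Real.sqrt m = b * Real.sqrt a := by
    rw [← hab]
    push_cast
    rw [Real.sqrt_mul (by positivity), Real.sqrt_sq (by positivity)]
  rw [hsum]
  calc _ ≤ ∑ d ∈ (2 * b).divisors, Real.sqrt a * (1 + Real.log m) :=
        (abs_sum_le_sum_abs _ _).trans (sum_le_sum fun d _ => hterm d)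
    _ ≤ (2 * b : ℕ) * (Real.sqrt a * (1 + Real.log m)) := by
        rw [sum_const, nsmul_eq_mul]
        gcongr
        exact Nat.card_divisors_le_self _
    _ = _ := by
        rw [hsqrt]
        push_cast
        ring

theorem hasSum_moebius_div_sq_odd :
    HasSum (fun n : ℕ => if Odd n then (ArithmeticFunction.moebius n : ℝ) / (n : ℝ) ^ 2 else 0)
      (8 / Real.pi ^ 2) := by
  set χ : DirichletCharacter ℂ 2 := 1 with hχ
  have hs : 1 < (2 : ℂ).re := by norm_num
  have hL : LSeries (fun n => χ n) 2 = (Real.pi : ℂ) ^ 2 / 8 := by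
    rw [← DirichletCharacter.LFunction_eq_LSeries χ hs]
    change DirichletCharacter.LFunctionTrivChar 2 2 = _
    rw [DirichletCharacter.LFunctionTrivChar_eq_mul_riemannZeta (by norm_num), riemannZeta_two,
      Nat.prime_two.primeFactors, prod_singleton, Complex.cpow_neg]
    norm_num
    ring
  have hpi : (Real.pi : ℂ) ≠ 0 := by exact_mod_cast Real.pi_ne_zero
  have hmul := DirichletCharacter.LSeries.mul_mu_eq_one χ hs
  rw [hL] at hmul
  have hval : LSeries ((fun n : ℕ => χ n) * fun n : ℕ => (ArithmeticFunction.moebius n : ℂ)) 2 =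
      ((8 / Real.pi ^ 2 : ℝ) : ℂ) := by
    push_cast
    field_simp
    linear_combination 8 * hmul
  have hsum := (DirichletCharacter.LSeriesSummable_mul χ
    (ArithmeticFunction.LSeriesSummable_moebius_iff.mpr hs)).LSeriesHasSum
  rw [hval, LSeriesHasSum] at hsum
  rw [← Complex.hasSum_ofReal]
  refine hsum.congr_fun fun n => ?_
  rcases eq_or_ne n 0 with rfl | hn
  · simp
  rw [LSeries.term_of_ne_zero hn]
  have hval' : χ n = if Odd n then 1 else 0 := by
    have hu : IsUnit (n : ZMod 2) ↔ Odd n := by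
      rw [ZMod.isUnit_iff_coprime, Nat.coprime_two_right]
    split_ifs with h
    · exact MulChar.one_apply (hu.2 h)
    · exact MulChar.map_nonunit _ (mt hu.1 h)
  simp only [Pi.mul_apply, hval']
  split_ifs <;> push_cast <;> simp

theorem abs_sum_moebius_div_sq_odd_sub_le (Z : ℕ) :
    |∑ d ∈ (Icc 1 Z).filter (fun d => Odd d), (ArithmeticFunction.moebius d : ℝ) / (d : ℝ) ^ 2 -
      8 / Real.pi ^ 2| ≤ 2 / (Z + 1 : ℝ) := by
  set f : ℕ → ℝ := fun n =>
    if Odd n then (ArithmeticFunction.moebius n : ℝ) / (n : ℝ) ^ 2 else 0 with hf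
  have hfin : ∑ d ∈ (Icc 1 Z).filter (fun d => Odd d),
      (ArithmeticFunction.moebius d : ℝ) / (d : ℝ) ^ 2 = ∑ n ∈ range (Z + 1), f n := by
    rw [sum_filter, range_eq_Ico, sum_eq_sum_Ico_succ_bot (Nat.succ_pos Z)]
    simp only [hf, Nat.not_odd_zero, if_false, zero_add]
    rfl
  have hbound (n : ℕ) : |f n| ≤ ((n : ℝ) ^ 2)⁻¹ := by
    have h1 : |(ArithmeticFunction.moebius n : ℝ)| ≤ 1 := by
      exact_mod_cast ArithmeticFunction.abs_moebius_le_one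
    simp only [hf]
    split_ifs
    · rw [abs_div, abs_of_nonneg (sq_nonneg (n : ℝ)), div_eq_mul_inv]
      exact mul_le_of_le_one_left (by positivity) h1
    · rw [abs_zero]
      positivity
  have hlim := (hasSum_moebius_div_sq_odd.tendsto_sum_nat.const_sub (∑ n ∈ range (Z + 1), f n)).abs
  rw [hfin]
  refine le_of_tendsto hlim ?_
  filter_upwards [Filter.eventually_ge_atTop (Z + 1)] with n hn
  rw [abs_sub_comm, ← sum_Ico_eq_sub _ hn]
  calc _ ≤ ∑ i ∈ Ioo Z n, ((i : ℝ) ^ 2)⁻¹ :=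
        (abs_sum_le_sum_abs _ _).trans (sum_le_sum fun i _ => hbound i)
    _ ≤ _ := sum_Ioo_inv_sq_le Z n

theorem card_filter_odd_Icc (n : ℕ) : ((Icc 1 n).filter (fun k => Odd k)).card = (n + 1) / 2 := by
  induction n with
  | zero => rfl
  | succ n ih =>
    rw [← insert_Icc_right_eq_Icc_add_one (by omega), filter_insert]
    split_ifs with h
    · rw [card_insert_of_notMem (by simp), ih]
      obtain ⟨k, hk⟩ := h
      omega
    · rw [ih]
      rw [Nat.not_odd_iff_even] at h
      obtain ⟨k, hk⟩ := h
      omega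

theorem abs_card_odd_multiples_sub_le {d : ℕ} (hd : 0 < d) (n : ℕ) :
    |((((n / d) + 1) / 2 : ℕ) : ℝ) - n / (2 * d)| ≤ 1 / 2 := by
  have hd0 : (0 : ℝ) < d := by exact_mod_cast hd
  set q := n / d with hq
  have h1 : (q : ℝ) ≤ n / d := Nat.cast_div_le
  have h2 : (n : ℝ) / d < q + 1 := by
    rw [div_lt_iff₀ hd0]
    exact_mod_cast Nat.lt_mul_of_div_lt (Nat.lt_succ_self q) hd
  have h3 : ((((q + 1) / 2 : ℕ) : ℝ)) ≤ (q + 1) / 2 := by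
    have := Nat.cast_div_le (α := ℝ) (m := q + 1) (n := 2)
    push_cast at this
    exact this
  have h4 : (q : ℝ) / 2 ≤ ((q + 1) / 2 : ℕ) := by
    have : q ≤ 2 * ((q + 1) / 2) := by omega
    have : (q : ℝ) ≤ 2 * ((q + 1) / 2 : ℕ) := by exact_mod_cast this
    linarith
  have e : (n : ℝ) / (2 * d) = n / d / 2 := by field_simp
  rw [e, abs_le]
  constructor <;> linarith

/-- The number of coprime pairs of odd integers `j ≤ Z`, `n ≤ N` is `2 / π ^ 2 * N * Z` up to
`O(N log Z)`. -/
theorem abs_sum_odd_coprime_sub_le {Z N : ℕ} (hZ : 0 < Z) (hZN : Z ≤ N) :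
    |∑ j ∈ (Icc 1 Z).filter (fun j => Odd j), ∑ n ∈ (Icc 1 N).filter (fun n => Odd n),
        (if n.Coprime j then 1 else 0 : ℝ) - 2 / Real.pi ^ 2 * N * Z| ≤
      N * (2 + Real.log Z) := by
  have hZ0 : (0 : ℝ) < Z := by exact_mod_cast hZ
  have hZN' : (Z : ℝ) ≤ N := by exact_mod_cast hZN
  have hcount (d M : ℕ) (hd : Odd d) :
      ∑ n ∈ (Icc 1 M).filter (fun n => Odd n), (if d ∣ n then 1 else 0 : ℝ) =
        ((((M / d) + 1) / 2 : ℕ) : ℝ) := by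
    rw [← card_filter_odd_Icc, card_eq_sum_ones, Nat.cast_sum, sum_filter, sum_filter,
      Nat.cast_one]
    have e := sum_Icc_filter_dvd (fun n => if Odd n then (1 : ℝ) else 0) hd.pos M
    simp only [Nat.odd_mul, hd, true_and] at e
    rw [← e, sum_filter]
    exact sum_congr rfl fun n _ => by split_ifs <;> rfl
  have hsum : ∑ j ∈ (Icc 1 Z).filter (fun j => Odd j), ∑ n ∈ (Icc 1 N).filter (fun n => Odd n),
        (if n.Coprime j then 1 else 0 : ℝ) =
      ∑ d ∈ (Icc 1 Z).filter (fun d => Odd d), (ArithmeticFunction.moebius d : ℝ) *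
        (((((Z / d) + 1) / 2 : ℕ) : ℝ) * ((((N / d) + 1) / 2 : ℕ) : ℝ)) := by
    have hind (j n : ℕ) (hj : j ∈ (Icc 1 Z).filter (fun j => Odd j)) :
        (if n.Coprime j then 1 else 0 : ℝ) = ∑ d ∈ (Icc 1 Z).filter (fun d => Odd d),
          (ArithmeticFunction.moebius d : ℝ) *
            ((if d ∣ j then 1 else 0) * (if d ∣ n then 1 else 0)) := by
      simp only [mem_filter, mem_Icc] at hj
      have h := congrArg (Int.cast : ℤ → ℝ)
        (sum_moebius_filter_dvd_eq_ite_coprime (by omega : j ≠ 0) n)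
      push_cast at h
      rw [← h]
      have hfil : j.divisors.filter (fun d => d ∣ n) =
          ((Icc 1 Z).filter (fun d => Odd d)).filter (fun d => d ∣ j ∧ d ∣ n) := by
        ext d
        simp only [mem_filter, Nat.mem_divisors, mem_Icc]
        constructor
        · rintro ⟨⟨h1, h2⟩, h3⟩
          have := Nat.le_of_dvd (by omega) h1
          exact ⟨⟨⟨Nat.pos_of_dvd_of_pos h1 (by omega), by omega⟩, hj.2.of_dvd_nat h1⟩, h1, h3⟩
        · rintro ⟨-, h1, h3⟩
          exact ⟨⟨h1, by omega⟩, h3⟩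
      rw [hfil, sum_filter]
      refine sum_congr rfl fun d _ => ?_
      by_cases h1 : d ∣ j <;> by_cases h2 : d ∣ n <;> simp [h1, h2]
    rw [sum_congr rfl fun j hj => sum_congr rfl fun n _ => hind j n hj]
    rw [sum_congr rfl fun j _ => sum_comm, sum_comm]
    refine sum_congr rfl fun d hd => ?_
    rw [← hcount d Z (mem_filter.1 hd).2, ← hcount d N (mem_filter.1 hd).2, sum_mul_sum, mul_sum]
    simp only [mul_sum]
  set P := ∑ d ∈ (Icc 1 Z).filter (fun d => Odd d),
    (ArithmeticFunction.moebius d : ℝ) / (d : ℝ) ^ 2 with hP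
  have hmain : |∑ d ∈ (Icc 1 Z).filter (fun d => Odd d), (ArithmeticFunction.moebius d : ℝ) *
        (((((Z / d) + 1) / 2 : ℕ) : ℝ) * ((((N / d) + 1) / 2 : ℕ) : ℝ)) - Z * N / 4 * P| ≤
      N * (1 + Real.log Z) := by
    rw [hP, mul_sum, ← sum_sub_distrib]
    calc _ ≤ ∑ d ∈ (Icc 1 Z).filter (fun d => Odd d), N * (d : ℝ)⁻¹ := by
          refine (abs_sum_le_sum_abs _ _).trans (sum_le_sum fun d hd => ?_)
          simp only [mem_filter, mem_Icc] at hd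
          have hd0 : (0 : ℝ) < d := by exact_mod_cast hd.1.1
          have hdN : (d : ℝ) ≤ N := by exact_mod_cast hd.1.2.trans hZN
          have h1 : |(ArithmeticFunction.moebius d : ℝ)| ≤ 1 := by
            exact_mod_cast ArithmeticFunction.abs_moebius_le_one
          have hz := abs_card_odd_multiples_sub_le hd.1.1 Z
          have hn := abs_card_odd_multiples_sub_le hd.1.1 N
          set A : ℝ := ((((Z / d) + 1) / 2 : ℕ) : ℝ) with hA
          set B : ℝ := ((((N / d) + 1) / 2 : ℕ) : ℝ) with hB
          have hB0 : 0 ≤ B := by positivity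
          set x : ℝ := N / (2 * d) with hx
          have hx1 : 1 / 2 ≤ x := by
            rw [hx, div_le_div_iff₀ (by norm_num) (by positivity)]
            linarith
          have hzx : (Z : ℝ) / (2 * d) ≤ x := by
            rw [hx]
            gcongr
          have hz0 : 0 ≤ (Z : ℝ) / (2 * d) := by positivity
          have e : (ArithmeticFunction.moebius d : ℝ) * (A * B) -
              Z * N / 4 * ((ArithmeticFunction.moebius d : ℝ) / (d : ℝ) ^ 2) =
              (ArithmeticFunction.moebius d : ℝ) *
                ((A - Z / (2 * d)) * B + Z / (2 * d) * (B - x)) := by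
            rw [hx]
            field_simp
            ring
          have e2 : (N : ℝ) * (d : ℝ)⁻¹ = 2 * x := by
            rw [hx]
            field_simp
          rw [e, e2, abs_mul]
          have hBx : B ≤ x + 1 / 2 := by linarith [(abs_le.1 hn).2]
          have h2 : |(A - Z / (2 * d)) * B + Z / (2 * d) * (B - x)| ≤
              1 / 2 * (x + 1 / 2) + x * (1 / 2) := by
            refine (abs_add_le _ _).trans ?_
            rw [abs_mul, abs_mul, abs_of_nonneg hB0, abs_of_nonneg hz0]
            gcongr
          calc _ ≤ 1 * (1 / 2 * (x + 1 / 2) + x * (1 / 2)) := by gcongr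
            _ ≤ 2 * x := by linarith
      _ ≤ ∑ d ∈ Icc 1 Z, N * (d : ℝ)⁻¹ :=
          sum_le_sum_of_subset_of_nonneg (filter_subset _ _) fun _ _ _ => by positivity
      _ ≤ _ := by
          rw [← mul_sum]
          have h := harmonic_le_one_add_log Z
          rw [harmonic_eq_sum_Icc] at h
          push_cast at h
          gcongr
  have hPerr : |Z * N / 4 * P - 2 / Real.pi ^ 2 * N * Z| ≤ (N : ℝ) := by
    have e : Z * N / 4 * P - 2 / Real.pi ^ 2 * N * Z = Z * N / 4 * (P - 8 / Real.pi ^ 2) := by ring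
    rw [e, abs_mul, abs_of_nonneg (by positivity)]
    calc (Z : ℝ) * N / 4 * |P - 8 / Real.pi ^ 2| ≤ Z * N / 4 * (2 / (Z + 1 : ℝ)) := by
          gcongr
          exact abs_sum_moebius_div_sq_odd_sub_le Z
      _ ≤ N := by
          rw [mul_div_assoc', div_le_iff₀ (by positivity)]
          nlinarith [mul_nonneg hZ0.le (hZ0.le.trans hZN')]
  rw [hsum]
  refine (abs_sub_le _ (Z * N / 4 * P) _).trans ?_
  linarith

theorem sum_filter_isSquare_Icc {R : Type*} [AddCommMonoid R] (f : ℕ → R) (M : ℕ) :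
    ∑ m ∈ (Icc 1 M).filter (fun m => Odd m ∧ IsSquare m), f m =
      ∑ j ∈ (Icc 1 M.sqrt).filter (fun j => Odd j), f (j ^ 2) := by
  symm
  refine sum_nbij' (fun j => j ^ 2) Nat.sqrt ?_ ?_ ?_ ?_ (fun _ _ => rfl)
  · intro j hj
    simp only [mem_filter, mem_Icc] at hj ⊢
    exact ⟨⟨Nat.pow_pos hj.1.1, Nat.le_sqrt'.1 hj.1.2⟩, hj.2.pow, IsSquare.sq j⟩
  · intro m hm
    simp only [mem_filter, mem_Icc] at hm ⊢
    obtain ⟨⟨h1, h2⟩, h3, r, rfl⟩ := hm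
    rw [Nat.sqrt_eq]
    exact ⟨⟨Nat.pos_of_mul_pos_left h1, Nat.le_sqrt.2 h2⟩, (Nat.odd_mul.1 h3).1⟩
  · intro j _
    exact Nat.sqrt_eq' j
  · intro m hm
    obtain ⟨r, rfl⟩ := (mem_filter.1 hm).2.2
    rw [Nat.sqrt_eq, sq]

theorem jacobiSym_sq_right {j : ℕ} (hj : j ≠ 0) (n : ℕ) :
    (jacobiSym n (j ^ 2) : ℝ) = if n.Coprime j then 1 else 0 := by
  have : NeZero j := ⟨hj⟩
  rw [jacobiSym.pow_right]
  split_ifs with h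
  · rw [jacobiSym.sq_one (by rwa [Int.gcd_natCast_natCast])]
    norm_num
  · rw [jacobiSym.eq_zero_iff_not_coprime.2 (by rwa [Int.gcd_natCast_natCast])]
    norm_num

/-- for `2 ≤ Y ≤ X`,
`∑_{m ≤ Y odd} ∑_{n ≤ X odd} (n/m) = (2/π²) X Y^(1/2)
  + O_ε(Y^(3/2) log Y + Y^(1/2) X^ε + X log Y)`. -/
theorem jacobi_double_sum :
    ∀ ε : ℝ, 0 < ε → ∃ C > (0:ℝ), ∀ X Y : ℝ, 2 ≤ Y → Y ≤ X →
      |(∑ m ∈ (Finset.Icc 1 ⌊Y⌋₊).filter (fun m => Odd m),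
          ∑ n ∈ (Finset.Icc 1 ⌊X⌋₊).filter (fun n => Odd n),
            ((jacobiSym (n : ℤ) m : ℤ) : ℝ))
        - 2 / Real.pi ^ 2 * X * Real.sqrt Y|
      ≤ C * (Y ^ ((3:ℝ)/2) * Real.log Y + Y ^ ((1:ℝ)/2) * X ^ ε + X * Real.log Y) := by
  intro ε _
  refine ⟨9, by norm_num, fun X Y hY hYX => ?_⟩
  have hX0 : 0 < X := by linarith
  have hY0 : 0 < Y := by linarith
  set M := ⌊Y⌋₊ with hM
  set N := ⌊X⌋₊ with hN
  set Z := M.sqrt with hZ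
  have hMY : (M : ℝ) ≤ Y := Nat.floor_le hY0.le
  have hNX : (N : ℝ) ≤ X := Nat.floor_le hX0.le
  have hM2 : 2 ≤ M := Nat.le_floor (by exact_mod_cast hY)
  have hMN : M ≤ N := Nat.floor_le_floor hYX
  have hZ0 : 0 < Z := Nat.sqrt_pos.2 (by omega)
  have hZM : Z ≤ M := Nat.sqrt_le_self M
  have hlog2 : 1 ≤ 2 * Real.log Y := by
    have := Real.log_two_gt_d9
    have := Real.log_le_log (by norm_num) hY
    linarith
  have hlogM (m : ℕ) (h0 : 0 < m) (h : m ≤ M) : Real.log m ≤ Real.log Y :=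
    Real.log_le_log (by exact_mod_cast h0) (le_trans (by exact_mod_cast h) hMY)
  set g : ℕ → ℝ := fun m => ∑ n ∈ (Icc 1 N).filter (fun n => Odd n), (jacobiSym n m : ℝ) with hg
  have hsplit : ∑ m ∈ (Icc 1 M).filter (fun m => Odd m), g m =
      ∑ m ∈ (Icc 1 M).filter (fun m => Odd m ∧ IsSquare m), g m +
        ∑ m ∈ (Icc 1 M).filter (fun m => Odd m ∧ ¬ IsSquare m), g m := by
    rw [← filter_filter, ← filter_filter, sum_filter_add_sum_filter_not]
  have hsq : |∑ m ∈ (Icc 1 M).filter (fun m => Odd m ∧ IsSquare m), g m -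
      2 / Real.pi ^ 2 * N * Z| ≤ X * (2 + Real.log Y) := by
    rw [sum_filter_isSquare_Icc]
    have h := abs_sum_odd_coprime_sub_le hZ0 (hZM.trans hMN)
    rw [← sum_congr rfl fun j hj => sum_congr rfl fun n _ =>
      jacobiSym_sq_right (j := j) (by simp only [mem_filter, mem_Icc] at hj; omega) n] at h
    refine h.trans ?_
    have := hlogM Z hZ0 hZM
    have := Real.log_natCast_nonneg Z
    gcongr
  have hnonsq : |∑ m ∈ (Icc 1 M).filter (fun m => Odd m ∧ ¬ IsSquare m), g m| ≤
      Y * (2 * Real.sqrt Y * (1 + Real.log Y)) := by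
    calc _ ≤ ∑ m ∈ (Icc 1 M).filter (fun m => Odd m ∧ ¬ IsSquare m),
          2 * Real.sqrt Y * (1 + Real.log Y) := by
          refine (abs_sum_le_sum_abs _ _).trans (sum_le_sum fun m hm => ?_)
          simp only [mem_filter, mem_Icc] at hm
          refine (abs_sum_Icc_filter_odd_jacobiSym_le hm.2.1 hm.2.2 N).trans ?_
          have := hlogM m hm.1.1 hm.1.2
          have := Real.log_natCast_nonneg m
          have : (m : ℝ) ≤ Y := le_trans (by exact_mod_cast hm.1.2) hMY
          gcongr
      _ ≤ _ := by
          rw [sum_const, nsmul_eq_mul]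
          have : (((Icc 1 M).filter (fun m => Odd m ∧ ¬ IsSquare m)).card : ℝ) ≤ Y := by
            refine le_trans ?_ hMY
            exact_mod_cast (card_filter_le _ _).trans (by simp)
          have : 0 ≤ Real.log Y := by linarith
          gcongr
  have hround : |2 / Real.pi ^ 2 * N * Z - 2 / Real.pi ^ 2 * X * Real.sqrt Y| ≤ 2 * X := by
    have hZY : (Z : ℝ) ≤ Real.sqrt Y :=
      Real.nat_sqrt_le_real_sqrt.trans (Real.sqrt_le_sqrt hMY)
    have hYZ : Real.sqrt Y ≤ Z + 1 := by
      rw [Real.sqrt_le_left (by positivity)]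
      have h1 : M + 1 ≤ (Z + 1) ^ 2 := Nat.lt_succ_sqrt' M
      have h2 : (M : ℝ) + 1 ≤ (Z + 1) ^ 2 := by exact_mod_cast h1
      exact (Nat.lt_floor_add_one Y).le.trans h2
    have hXN : X ≤ N + 1 := (Nat.lt_floor_add_one X).le
    have hsX : Real.sqrt Y ≤ X := by
      rw [Real.sqrt_le_left hX0.le]
      nlinarith
    have hpi : 2 / Real.pi ^ 2 ≤ 1 := by
      rw [div_le_one (by positivity)]
      nlinarith [Real.pi_gt_three]
    have e : 2 / Real.pi ^ 2 * N * Z - 2 / Real.pi ^ 2 * X * Real.sqrt Y =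
        -(2 / Real.pi ^ 2 * ((X - N) * Real.sqrt Y + N * (Real.sqrt Y - Z))) := by ring
    have h0 : 0 ≤ (X - N) * Real.sqrt Y + N * (Real.sqrt Y - Z) := by
      have := mul_nonneg (sub_nonneg.2 hNX) (Real.sqrt_nonneg Y)
      have := mul_nonneg (Nat.cast_nonneg (α := ℝ) N) (sub_nonneg.2 hZY)
      linarith
    rw [e, abs_neg, abs_of_nonneg (by positivity)]
    refine (mul_le_of_le_one_left h0 hpi).trans ?_
    have h1 : (X - N) * Real.sqrt Y ≤ 1 * X := by
      gcongr
      linarith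
    have h2 : N * (Real.sqrt Y - Z) ≤ X * 1 := by
      gcongr
      linarith
    linarith
  have hpow : Y ^ ((3 : ℝ) / 2) = Y * Real.sqrt Y := by
    rw [Real.sqrt_eq_rpow, show (3 : ℝ) / 2 = 1 + 1 / 2 by norm_num, Real.rpow_add hY0,
      Real.rpow_one]
  have hmid : 0 ≤ Y ^ ((1 : ℝ) / 2) * X ^ ε := by positivity
  have hbig : Y * Real.sqrt Y * 1 ≤ Y * Real.sqrt Y * (2 * Real.log Y) := by gcongr
  have hbigX : X * 1 ≤ X * (2 * Real.log Y) := by gcongr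
  have hpos : 0 ≤ Y * Real.sqrt Y * Real.log Y := by
    have : 0 ≤ Real.log Y := by linarith
    positivity
  rw [hsplit, hpow]
  rw [abs_le] at *
  constructor <;> nlinarith
end
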